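/- arXiv:0807.1963 — 2 statements merged into one kernel-verified Lean document; each statement's English description precedes it below -/
import Mathlib

section
/- (Energy image density for an infinite product.) For i ∈ ℕ* let k_i: ℝ^r → [0,∞) be Borel with ∫ k_i dx = 1 and ξ^i be symmetric matrix-valued Borel, each pair (k_i, ξ^i) satisfying hypotheses (HG), with associated Dirichlet structures (𝐝_i, e_i, γ_i). On the product space (ℝ^r)^{ℕ*} with product probability Λ = ⊗_{i=1}^∞ k_i dx, let 𝐝̃ be the infinite product domain with carré du champ γ̃[U] = Σ_k γ_k[U] (γ_k acting on the k-th block of coordinates). Then for every d ∈ ℕ* and every U ∈ 𝐝̃^d, the image measure U_*[ det(γ̃[U_i,U_j])_{1≤i,j≤d} · Λ ] is absolutely continuous with respect to λ^d. -/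
open MeasureTheory Set Filter

noncomputable section

/-- `Rset ρ` : the largest open subset of `ℝ` on which `ρ⁻¹` is locally integrable. -/
def Rset (ρ : ℝ → ℝ) : Set ℝ :=
  {t : ℝ | ∃ ε > (0 : ℝ), IntegrableOn (fun s => (ρ s)⁻¹) (Ioo (t - ε) (t + ε)) volume}

/-- Hypotheses (HG) for the pair `(k, ξ)` on `ℝ^r`:
`k` is a nonnegative Borel function whose one-dimensional sections satisfy the
generalized Hamza condition, and `ξ` is a symmetric Borel matrix-valued function
which is locally elliptic on an open set of full Lebesgue measure. -/
structure HG (r : ℕ) (k : (Fin r → ℝ) → ℝ) (ξ : Fin r → Fin r → (Fin r → ℝ) → ℝ) : Prop where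
  k_meas : Measurable k
  k_nonneg : ∀ x, 0 ≤ k x
  hamza : ∀ i : Fin r, ∀ᵐ x ∂(volume : Measure (Fin r → ℝ)),
    (0 < ∫ s : ℝ, k (Function.update x i s)) →
      ∀ᵐ s ∂(volume : Measure ℝ),
        s ∉ Rset (fun t => k (Function.update x i t)) → k (Function.update x i s) = 0
  xi_meas : ∀ i j, Measurable (ξ i j)
  xi_symm : ∀ i j x, ξ i j x = ξ j i x
  elliptic : ∃ O : Set (Fin r → ℝ), IsOpen O ∧ volume Oᶜ = 0 ∧
    ∀ K : Set (Fin r → ℝ), K ⊆ O → IsCompact K → ∃ c > (0 : ℝ), ∀ x ∈ K, ∀ v : Fin r → ℝ,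
      c * (∑ i, v i ^ 2) ≤ ∑ i, ∑ j, ξ i j x * v i * v j

/-- Membership of `u` in the domain `𝐝` of the form associated to `(k, ξ)`,
with partial-derivative data `du` : `u` is a Borel function of `L²(k dx)`,
λ^{r-1}-almost every one-dimensional section of `u` along the `i`-th coordinate
admits an absolutely continuous version on `R(k^{(i)}_{x̄})` whose derivative is
the corresponding section of `du i`, and `Σ_{i,j} ξ_{ij} ∂_i u ∂_j u ∈ L¹(k dx)`. -/
structure MemDom (r : ℕ) (k : (Fin r → ℝ) → ℝ) (ξ : Fin r → Fin r → (Fin r → ℝ) → ℝ)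
    (u : (Fin r → ℝ) → ℝ) (du : Fin r → (Fin r → ℝ) → ℝ) : Prop where
  meas : Measurable u
  du_meas : ∀ i, Measurable (du i)
  memL2 : Integrable (fun x => u x ^ 2 * k x) volume
  sectionsAC : ∀ i : Fin r, ∀ᵐ x ∂(volume : Measure (Fin r → ℝ)),
    ∃ v : ℝ → ℝ,
      (∀ᵐ s ∂(volume : Measure ℝ), s ∈ Rset (fun t => k (Function.update x i t)) →
        v s = u (Function.update x i s)) ∧
      ∀ a b : ℝ, a ≤ b → Icc a b ⊆ Rset (fun t => k (Function.update x i t)) →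
        IntegrableOn (fun s => du i (Function.update x i s)) (Icc a b) volume ∧
        v b - v a = ∫ s in a..b, du i (Function.update x i s)
  energyInt : Integrable (fun x => (∑ i, ∑ j, ξ i j x * du i x * du j x) * k x) volume

/-- The Dirichlet form `e[u] = ½ ∫ Σ_{i,j} ξ_{ij} ∂_i u ∂_j u k dx`, expressed through
the partial-derivative data `du` of `u`. -/
def energy (r : ℕ) (k : (Fin r → ℝ) → ℝ) (ξ : Fin r → Fin r → (Fin r → ℝ) → ℝ)
    (du : Fin r → (Fin r → ℝ) → ℝ) : ℝ :=
  (1 / 2) * ∫ x, (∑ i, ∑ j, ξ i j x * du i x * du j x) * k x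


/-- Membership of `U` in the infinite product domain `𝐝̃` on `((ℝ^r)^{ℕ*}, Λ)`, with
partial-derivative data `dU i j`: `U ∈ L²(Λ)`, for each `i` and `Λ`-almost all fixed
values of the other coordinates the `i`-th partial map belongs to `𝐝_i`, and
`ẽ(U) = Σ_i ∫ e_i[i-th partial map of U] dΛ < ∞`. -/
structure MemDomInfProd (r : ℕ) (k : ℕ → (Fin r → ℝ) → ℝ)
    (ξ : ℕ → Fin r → Fin r → (Fin r → ℝ) → ℝ)
    (Λ : Measure (ℕ → Fin r → ℝ))
    (U : (ℕ → Fin r → ℝ) → ℝ)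
    (dU : ℕ → Fin r → (ℕ → Fin r → ℝ) → ℝ) : Prop where
  meas : Measurable U
  dU_meas : ∀ i j, Measurable (dU i j)
  memL2 : Integrable (fun x => U x ^ 2) Λ
  partialMem : ∀ i : ℕ, ∀ᵐ x ∂Λ,
    MemDom r (k i) (ξ i) (fun y => U (Function.update x i y))
      (fun j => fun y => dU i j (Function.update x i y))
  energySum : (∑' i : ℕ, ∫⁻ x, ENNReal.ofReal
      (energy r (k i) (ξ i) (fun j => fun y => dU i j (Function.update x i y))) ∂Λ) < ⊤

open scoped Topology

section LineDerivatives

lemma measurableSet_ae_right {α β : Type*} [MeasurableSpace α] [MeasurableSpace β]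
    {μ : Measure β} [SFinite μ] {p : α → β → Prop} (h : MeasurableSet {z : α × β | p z.1 z.2}) :
    MeasurableSet {x | ∀ᵐ t ∂μ, p x t} := by
  simp only [ae_iff]
  exact measurable_measure_prodMk_left h.compl (measurableSet_singleton 0)

/-- Almost no point of `D` lies on a line in direction `e` that meets `D` in a null set. -/
lemma ae_notMem_of_lines {ι : Type*} [Fintype ι] (e : ι → ℝ) {D : Set (ι → ℝ)}
    (hD : MeasurableSet D) :
    ∀ᵐ y : ι → ℝ, (∀ᵐ t : ℝ, y + t • e ∉ D) → y ∉ D := by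
  have hadd : Measurable fun z : (ι → ℝ) × ℝ => z.1 + z.2 • e := by fun_prop
  set D' : Set (ι → ℝ) := {y | y ∈ D ∧ ∀ᵐ t : ℝ, y + t • e ∉ D} with hD'
  have hD'm : MeasurableSet D' := hD.inter (measurableSet_ae_right (hadd hD.compl))
  have hlines : ∀ y : ι → ℝ, ∀ᵐ s : ℝ, y + s • e ∉ D' := by
    intro y
    by_cases h : ∃ s₀ : ℝ, y + s₀ • e ∈ D'
    · obtain ⟨s₀, -, hs₀⟩ := h
      have hq := (measurePreserving_sub_right (volume : Measure ℝ) s₀).quasiMeasurePreserving.ae hs₀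
      filter_upwards [hq] with s hs hsD
      apply hs
      convert hsD.1 using 1
      rw [add_assoc, ← add_smul]
      simp
    · push Not at h
      exact Eventually.of_forall h
  have hswap := (Measure.ae_ae_comm (μ := (volume : Measure (ι → ℝ))) (ν := (volume : Measure ℝ))
    (p := fun y s => y + s • e ∉ D') (hadd hD'm.compl)).1 (Eventually.of_forall hlines)
  obtain ⟨s, hs⟩ := hswap.exists
  have hq := (measurePreserving_sub_right (volume : Measure (ι → ℝ))
    (s • e)).quasiMeasurePreserving.ae hs
  filter_upwards [hq] with y hy h hyD
  apply hy
  rw [sub_add_cancel]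
  exact ⟨hyD, h⟩

/-- `g` is the derivative of `f` at `x` in direction `e`, null sets of the line being ignored. -/
def LineDiff {V F : Type*} [AddCommGroup V] [Module ℝ V] [NormedAddCommGroup F] [NormedSpace ℝ F]
    (f : V → F) (e : V) (g : F) (x : V) : Prop :=
  ∀ m : ℕ, ∃ n : ℕ, ∀ᵐ t : ℝ, |t| < 1 / (n + 1) →
    ‖f (x + t • e) - f x - t • g‖ ≤ 1 / (m + 1) * |t|

lemma measurableSet_lineDiff {V F : Type*} [AddCommGroup V] [Module ℝ V] [NormedAddCommGroup F]
    [NormedSpace ℝ F] [MeasurableSpace V] [MeasurableAdd₂ V] [MeasurableSMul₂ ℝ V]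
    [MeasurableSpace F] [BorelSpace F]
    [SecondCountableTopology F] {f g : V → F} (hf : Measurable f) (hg : Measurable g) (e : V) :
    MeasurableSet {x | LineDiff f e (g x) x} := by
  simp only [LineDiff, Set.ofPred_forall, Set.ofPred_exists]
  refine MeasurableSet.iInter fun m => MeasurableSet.iUnion fun n => measurableSet_ae_right ?_
  have h1 : Measurable fun z : V × ℝ => ‖f (z.1 + z.2 • e) - f z.1 - z.2 • g z.1‖ := by
    have : Measurable fun z : V × ℝ => f (z.1 + z.2 • e) :=
      hf.comp (measurable_fst.add (measurable_snd.smul_const e))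
    fun_prop
  have h2 : MeasurableSet {z : V × ℝ | |z.2| < 1 / ((n : ℝ) + 1)} :=
    measurableSet_lt (by fun_prop) measurable_const
  have h3 := measurableSet_le h1
    (show Measurable fun z : V × ℝ => 1 / ((m : ℝ) + 1) * |z.2| by fun_prop)
  convert h2.compl.union h3 using 1
  ext z
  simp [imp_iff_not_or]

lemma lineDiff_pi {V α : Type*} [AddCommGroup V] [Module ℝ V] [Fintype α]
    {f : V → α → ℝ} {e : V} {g : α → ℝ} {x : V}
    (h : ∀ a, LineDiff (fun y => f y a) e (g a) x) : LineDiff f e g x := by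
  intro m
  choose n hn using fun a => h a m
  refine ⟨∑ a, n a, ?_⟩
  filter_upwards [ae_all_iff.2 hn] with t ht htn
  refine (pi_norm_le_iff_of_nonneg (by positivity)).2 fun a => ?_
  have hle : n a ≤ ∑ a, n a := Finset.single_le_sum (fun _ _ => Nat.zero_le _) (Finset.mem_univ a)
  have := ht a (htn.trans_le (one_div_le_one_div_of_le (by positivity)
    (by exact_mod_cast Nat.succ_le_succ hle)))
  simpa using this

lemma LineDiff.exists_of_pos {V F : Type*} [AddCommGroup V] [Module ℝ V] [NormedAddCommGroup F]
    [NormedSpace ℝ F] {f : V → F} {e : V} {g : F} {x : V} (h : LineDiff f e g x)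
    {ε : ℝ} (hε : 0 < ε) : ∃ δ > 0, ∀ᵐ t : ℝ, |t| < δ →
      ‖f (x + t • e) - f x - t • g‖ ≤ ε * |t| := by
  obtain ⟨m, hm⟩ := exists_nat_one_div_lt hε
  obtain ⟨n, hn⟩ := h m
  refine ⟨1 / (n + 1), by positivity, ?_⟩
  filter_upwards [hn] with t ht htn
  exact (ht htn).trans (by gcongr)

end LineDerivatives

section Resampling

lemma measurePreserving_update_infinitePi {ι : Type*} [DecidableEq ι] {X : ι → Type*}
    [∀ i, MeasurableSpace (X i)] (μ : ∀ i, Measure (X i)) [∀ i, IsProbabilityMeasure (μ i)]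
    (i : ι) :
    MeasurePreserving (fun z : (∀ i, X i) × X i => Function.update z.1 i z.2)
      ((Measure.infinitePi μ).prod (μ i)) (Measure.infinitePi μ) := by
  have hm : Measurable fun z : (∀ i, X i) × X i => Function.update z.1 i z.2 := by
    refine measurable_pi_iff.2 fun j => ?_
    by_cases h : j = i
    · subst h
      simpa using measurable_snd
    · simp only [Function.update_of_ne h]
      fun_prop
  refine ⟨hm, Measure.eq_infinitePi _ fun s t ht => ?_⟩
  have hts : MeasurableSet (Set.pi (s : Set ι) t) :=
    MeasurableSet.pi s.countable_toSet fun j hj => ht j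
  rw [Measure.map_apply hm hts]
  by_cases his : i ∈ s
  · have : (fun z : (∀ i, X i) × X i => Function.update z.1 i z.2) ⁻¹' (Set.pi (s : Set ι) t)
        = (Set.pi ((s.erase i : Finset ι) : Set ι) t) ×ˢ (t i) := by
      ext z
      simp only [mem_preimage, Set.mem_pi, mem_prod, Finset.mem_coe, Finset.mem_erase]
      constructor
      · intro h
        refine ⟨fun j hj => ?_, by simpa using h i his⟩
        simpa [Function.update_of_ne hj.1] using h j hj.2
      · rintro ⟨h1, h2⟩ j hj
        by_cases hji : j = i
        · subst hji
          simpa using h2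
        · simpa [Function.update_of_ne hji] using h1 j ⟨hji, hj⟩
    rw [this, Measure.prod_prod, Measure.infinitePi_pi _ (fun j _ => ht j),
      Finset.prod_erase_mul _ _ his]
  · have : (fun z : (∀ i, X i) × X i => Function.update z.1 i z.2) ⁻¹' (Set.pi (s : Set ι) t)
        = (Set.pi (s : Set ι) t) ×ˢ univ := by
      ext z
      simp only [mem_preimage, Set.mem_pi, mem_prod, Finset.mem_coe, mem_univ, and_true]
      refine forall₂_congr fun j hj => ?_
      rw [Function.update_of_ne (by rintro rfl; exact his hj)]
    rw [this, Measure.prod_prod, Measure.infinitePi_pi _ (fun j _ => ht j), measure_univ, mul_one]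

end Resampling

section ApproximateDifferentiability

/-- The uniform distribution on the interval of length one centred at the origin. -/
def unitInterval₀ : Measure ℝ := volume.restrict (Metric.closedBall 0 (1 / 2))

instance : IsProbabilityMeasure unitInterval₀ := ⟨by
  rw [unitInterval₀, Measure.restrict_apply_univ, Real.volume_closedBall]
  norm_num⟩

/-- The uniform distribution on the unit cube centred at the origin. -/
def unitCube₀ (ι : Type*) [Fintype ι] : Measure (ι → ℝ) := Measure.pi fun _ => unitInterval₀

instance (ι : Type*) [Fintype ι] : IsProbabilityMeasure (unitCube₀ ι) := by
  unfold unitCube₀; infer_instance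

variable {ι : Type*} [Fintype ι]

lemma unitCube₀_eq : unitCube₀ ι = volume.restrict (Metric.closedBall 0 (1 / 2)) := by
  rw [unitCube₀, closedBall_pi _ (by norm_num), volume_pi, Measure.restrict_pi_pi]
  rfl

lemma ae_unitInterval₀_abs_le : ∀ᵐ t ∂unitInterval₀, |t| ≤ 1 / 2 := by
  filter_upwards [ae_restrict_mem (μ := volume)
    (Metric.isClosed_closedBall (x := (0 : ℝ)) (ε := 1 / 2)).measurableSet]
    with t ht
  simpa using ht

lemma ae_unitCube₀_abs_le : ∀ᵐ w ∂unitCube₀ ι, ∀ c, |w c| ≤ 1 / 2 := by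
  rw [unitCube₀_eq]
  filter_upwards [ae_restrict_mem (μ := volume)
    (Metric.isClosed_closedBall (x := (0 : ι → ℝ)) (ε := 1 / 2)).measurableSet]
    with w hw c
  exact (norm_le_pi_norm w c).trans (by simpa using hw)

lemma unitInterval₀_preimage_scale {S : Set ℝ} (s : ℝ) {ρ : ℝ} (hρ : 0 < ρ) :
    unitInterval₀ {t | s + ρ * t ∈ S} =
      volume (S ∩ Metric.closedBall s (ρ / 2)) / volume (Metric.closedBall s (ρ / 2)) := by
  have h1 : {t | s + ρ * t ∈ S} ∩ Metric.closedBall 0 (1 / 2) =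
      (ρ * ·) ⁻¹' ((s + ·) ⁻¹' (S ∩ Metric.closedBall s (ρ / 2))) := by
    ext t
    simp only [mem_inter_iff, Set.mem_ofPred_eq, Metric.mem_closedBall, mem_preimage,
      Real.dist_eq, sub_zero, add_sub_cancel_left, abs_mul, abs_of_pos hρ]
    refine and_congr_right fun _ => ⟨fun h => ?_, fun h => ?_⟩
    · nlinarith
    · by_contra hc
      nlinarith
  rw [unitInterval₀, Measure.restrict_apply' Metric.isClosed_closedBall.measurableSet, h1,
    Real.volume_preimage_mul_left hρ.ne', measure_preimage_add, Real.volume_closedBall,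
    abs_of_pos (inv_pos.2 hρ), ENNReal.ofReal_inv_of_pos hρ, mul_comm, ← div_eq_mul_inv]
  congr 2
  ring

lemma tendsto_half_pow : Tendsto (fun k : ℕ => (1 / 2 : ℝ) ^ k) atTop (𝓝 0) :=
  tendsto_pow_atTop_nhds_zero_of_lt_one (by norm_num) (by norm_num)

/-- Lebesgue's density theorem along the lines in direction `e`. -/
lemma ae_tendsto_density_line (e : ι → ℝ) {A : Set (ι → ℝ)} (hA : MeasurableSet A) :
    ∀ᵐ x : ι → ℝ, x ∈ A → Tendsto
      (fun k : ℕ => unitInterval₀ {t | x + ((1 / 2 : ℝ) ^ k * t) • e ∉ A}) atTop (𝓝 0) := by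
  set F : ℕ → (ι → ℝ) → ENNReal :=
    fun k x => unitInterval₀ {t | x + ((1 / 2 : ℝ) ^ k * t) • e ∉ A} with hF
  have hFm : ∀ k, Measurable (F k) := fun k => by
    have hm : Measurable fun z : (ι → ℝ) × ℝ => z.1 + ((1 / 2 : ℝ) ^ k * z.2) • e := by fun_prop
    exact measurable_measure_prodMk_left (hm hA.compl)
  set D : Set (ι → ℝ) := A ∩ {x | Tendsto (fun k => F k x) atTop (𝓝 0)}ᶜ with hD
  have hDm : MeasurableSet D :=
    hA.inter (measurableSet_tendsto (𝓝 0) hFm).compl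
  filter_upwards [ae_notMem_of_lines e hDm] with x hx hxA
  have hlines : ∀ᵐ s : ℝ, x + s • e ∉ D := by
    have hSm : MeasurableSet {s : ℝ | x + s • e ∉ A} := by
      have hm : Measurable fun s : ℝ => x + s • e := by fun_prop
      exact hm hA.compl
    filter_upwards [Besicovitch.ae_tendsto_measure_inter_div_of_measurableSet volume hSm]
      with s hs hsD
    refine hsD.2 ?_
    have hnot : s ∉ {s : ℝ | x + s • e ∉ A} := fun h => h hsD.1
    rw [indicator_of_notMem hnot] at hs
    have hr : Tendsto (fun k : ℕ => (1 / 2 : ℝ) ^ k / 2) atTop (𝓝[>] 0) := by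
      refine tendsto_nhdsWithin_iff.2 ⟨?_, Eventually.of_forall fun k => ?_⟩
      · simpa using tendsto_half_pow.div_const 2
      · exact mem_Ioi.2 (by positivity)
    refine (hs.comp hr).congr fun k => ?_
    rw [Function.comp_apply, ← unitInterval₀_preimage_scale s (by positivity)]
    simp only [hF, Set.mem_ofPred_eq, add_smul, add_assoc]
  by_contra hcon
  exact hx hlines ⟨hxA, hcon⟩

variable [DecidableEq ι] {F : Type*} [NormedAddCommGroup F] [NormedSpace ℝ F]

/-- The increments `w` along which `f`, at the scale `2⁻ᵏ` and in the coordinates `s`, is not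
`ε`-close to its linearization at `x` with partial derivatives `g x`. -/
def badSet (f : (ι → ℝ) → F) (g : (ι → ℝ) → ι → F) (s : Finset ι) (k : ℕ) (ε : ℝ)
    (x : ι → ℝ) : Set (ι → ℝ) :=
  {w | ε * (1 / 2) ^ k < ‖f (x + (1 / 2 : ℝ) ^ k • ∑ c ∈ s, w c • Pi.single c (1 : ℝ)) - f x
    - (1 / 2 : ℝ) ^ k • ∑ c ∈ s, w c • g x c‖}

omit [Fintype ι] in
lemma badSet_anti (f : (ι → ℝ) → F) (g : (ι → ℝ) → ι → F) (s : Finset ι) (k : ℕ) {ε ε' : ℝ}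
    (h : ε' ≤ ε) (x : ι → ℝ) : badSet f g s k ε x ⊆ badSet f g s k ε' x :=
  fun _ hw => (mul_le_mul_of_nonneg_right h (by positivity)).trans_lt hw

variable [MeasurableSpace F] [BorelSpace F] [SecondCountableTopology F]
  {f : (ι → ℝ) → F} {g : (ι → ℝ) → ι → F}

omit [Fintype ι] in
lemma measurableSet_badSet_prod (hf : Measurable f) (hg : Measurable g) (s : Finset ι) (k : ℕ)
    (ε : ℝ) : MeasurableSet {z : (ι → ℝ) × (ι → ℝ) | z.2 ∈ badSet f g s k ε z.1} := by
  have h1 : Measurable fun z : (ι → ℝ) × (ι → ℝ) =>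
      z.1 + (1 / 2 : ℝ) ^ k • ∑ c ∈ s, z.2 c • (Pi.single c (1 : ℝ) : ι → ℝ) := by fun_prop
  have h2 : Measurable fun z : (ι → ℝ) × (ι → ℝ) => ∑ c ∈ s, z.2 c • g z.1 c := by fun_prop
  exact measurableSet_lt measurable_const
    (((hf.comp h1).sub (hf.comp measurable_fst)).sub (h2.const_smul _)).norm

omit [Fintype ι] in
lemma measurableSet_badSet (hf : Measurable f) (hg : Measurable g) (s : Finset ι) (k : ℕ)
    (ε : ℝ) (x : ι → ℝ) : MeasurableSet (badSet f g s k ε x) :=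
  measurable_prodMk_left (measurableSet_badSet_prod hf hg s k ε)

lemma measurable_measure_badSet (hf : Measurable f) (hg : Measurable g) (s : Finset ι) (k : ℕ)
    (ε : ℝ) : Measurable fun x => unitCube₀ ι (badSet f g s k ε x) :=
  measurable_measure_prodMk_left (measurableSet_badSet_prod hf hg s k ε)

lemma measurePreserving_update_unitCube₀ (j : ι) :
    MeasurePreserving (fun z : (ι → ℝ) × ℝ => Function.update z.1 j z.2)
      ((unitCube₀ ι).prod unitInterval₀) (unitCube₀ ι) := by
  have := measurePreserving_update_infinitePi (fun _ : ι => unitInterval₀) j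
  rwa [Measure.infinitePi_eq_pi] at this

lemma measure_badSet_insert_le (hf : Measurable f) (hg : Measurable g) {s : Finset ι} {j : ι}
    (hj : j ∉ s) {A : Set (ι → ℝ)} {x : ι → ℝ} {k : ℕ} {ε : ℝ} {δ δ' : ENNReal}
    (hgA : ∀ x' ∈ A, ∀ c, ‖g x' c - g x c‖ ≤ 2 * ε)
    (hA : ∀ x' ∈ A, unitCube₀ ι (badSet f g s k ε x') ≤ δ)
    (hdens : unitInterval₀ {t | x + ((1 / 2 : ℝ) ^ k * t) • Pi.single j (1 : ℝ) ∉ A} ≤ δ')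
    (hline : ∀ᵐ t ∂unitInterval₀,
      ‖f (x + ((1 / 2 : ℝ) ^ k * t) • Pi.single j (1 : ℝ)) - f x - ((1 / 2 : ℝ) ^ k * t) • g x j‖
        ≤ ε * (1 / 2) ^ k) :
    unitCube₀ ι (badSet f g (insert j s) k ((2 + Fintype.card ι) * ε) x) ≤ δ + δ' := by
  have hB := measurableSet_badSet hf hg (insert j s) k ((2 + Fintype.card ι) * ε) x
  have hmp := measurePreserving_update_unitCube₀ (ι := ι) j
  set N : Set ℝ := {t | x + ((1 / 2 : ℝ) ^ k * t) • Pi.single j (1 : ℝ) ∉ A} with hN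
  rw [← hmp.measure_preimage hB.nullMeasurableSet, Measure.prod_apply_symm (hmp.measurable hB)]
  have hρ : (0 : ℝ) < (1 / 2) ^ k := by positivity
  set ρ : ℝ := (1 / 2) ^ k with hρdef
  calc _ ≤ ∫⁻ t, (δ + N.indicator 1 t) ∂unitInterval₀ := by
        refine lintegral_mono_ae ?_
        filter_upwards [hline] with t ht
        by_cases htN : t ∈ N
        · rw [indicator_of_mem htN]
          exact prob_le_one.trans le_add_self
        · rw [indicator_of_notMem htN, add_zero]
          set x' := x + (ρ * t) • Pi.single j (1 : ℝ) with hx'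
          have hx'A : x' ∈ A := not_not.1 htN
          refine (measure_mono_ae ?_).trans (hA x' hx'A)
          filter_upwards [ae_unitCube₀_abs_le (ι := ι)] with w hw hwB
          by_contra hcon
          have hcon' : ‖f (x' + ρ • ∑ c ∈ s, w c • Pi.single c (1 : ℝ)) - f x'
              - ρ • ∑ c ∈ s, w c • g x' c‖ ≤ ε * ρ := not_lt.1 hcon
          have hwB' : (2 + Fintype.card ι) * ε * ρ <
              ‖f (x + ρ • ∑ c ∈ insert j s, Function.update w j t c • Pi.single c (1 : ℝ)) - f x
                - ρ • ∑ c ∈ insert j s, Function.update w j t c • g x c‖ := hwB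
          have hupd : ∀ c ∈ s, Function.update w j t c = w c := fun c hc =>
            Function.update_of_ne (by rintro rfl; exact hj hc) _ _
          have e1 : ∑ c ∈ insert j s, Function.update w j t c • (Pi.single c (1 : ℝ) : ι → ℝ)
              = t • Pi.single j (1 : ℝ) + ∑ c ∈ s, w c • Pi.single c (1 : ℝ) := by
            rw [Finset.sum_insert hj, Function.update_self]
            congr 1
            exact Finset.sum_congr rfl fun c hc => by rw [hupd c hc]
          have e2 : ∑ c ∈ insert j s, Function.update w j t c • g x c
              = t • g x j + ∑ c ∈ s, w c • g x c := by
            rw [Finset.sum_insert hj, Function.update_self]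
            congr 1
            exact Finset.sum_congr rfl fun c hc => by rw [hupd c hc]
          rw [e1, e2, smul_add, ← add_assoc, smul_smul, ← hx', smul_add, smul_smul] at hwB'
          have hε : 0 ≤ ε := by
            have := (norm_nonneg _).trans (hgA x' hx'A j)
            linarith
          have hsum : ‖∑ c ∈ s, w c • (g x' c - g x c)‖ ≤ Fintype.card ι * ε := by
            refine (norm_sum_le_of_le s (f := fun c => w c • (g x' c - g x c)) (n := fun _ => ε)
              fun c _ => ?_).trans ?_
            · rw [norm_smul, Real.norm_eq_abs]
              calc |w c| * ‖g x' c - g x c‖ ≤ 1 / 2 * (2 * ε) :=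
                    mul_le_mul (hw c) (hgA x' hx'A c) (norm_nonneg _) (by norm_num)
                _ = ε := by ring
            · rw [Finset.sum_const, nsmul_eq_mul]
              gcongr
              exact Finset.card_le_univ s
          have e3 : f (x' + ρ • ∑ c ∈ s, w c • Pi.single c (1 : ℝ)) - f x
              - ((ρ * t) • g x j + ρ • ∑ c ∈ s, w c • g x c)
              = (f (x' + ρ • ∑ c ∈ s, w c • Pi.single c (1 : ℝ)) - f x'
                - ρ • ∑ c ∈ s, w c • g x' c) + (f x' - f x - (ρ * t) • g x j)
                + ρ • ∑ c ∈ s, w c • (g x' c - g x c) := by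
            simp only [smul_sub, Finset.sum_sub_distrib]
            abel
          rw [e3] at hwB'
          have hn := norm_add₃_le (a := f (x' + ρ • ∑ c ∈ s, w c • Pi.single c (1 : ℝ)) - f x'
                - ρ • ∑ c ∈ s, w c • g x' c) (b := f x' - f x - (ρ * t) • g x j)
                (c := ρ • ∑ c ∈ s, w c • (g x' c - g x c))
          rw [norm_smul ρ, Real.norm_of_nonneg hρ.le] at hn
          nlinarith [mul_le_mul_of_nonneg_left hsum hρ.le]
    _ ≤ δ + δ' := by
        rw [lintegral_add_left measurable_const, lintegral_const, measure_univ, mul_one]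
        gcongr
        exact (lintegral_indicator_one_le N).trans hdens

/-- A function with partial derivatives at the points of `G` is approximately differentiable at
almost every point of `G`. -/
theorem ae_tendsto_measure_badSet (hf : Measurable f) (hg : Measurable g) {G : Set (ι → ℝ)}
    (hG : MeasurableSet G) (hline : ∀ x ∈ G, ∀ c, LineDiff f (Pi.single c (1 : ℝ)) (g x c) x)
    (s : Finset ι) : ∀ᵐ x, x ∈ G → ∀ ε > 0,
      Tendsto (fun k => unitCube₀ ι (badSet f g s k ε x)) atTop (𝓝 0) := by
  induction s using Finset.induction_on with
  | empty =>
    refine Eventually.of_forall fun x _ ε hε => ?_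
    have : ∀ k, badSet f g ∅ k ε x = ∅ := fun k => by
      refine eq_empty_of_forall_notMem fun w hw => ?_
      have hw' : ε * (1 / 2) ^ k < _ := hw
      simp only [Finset.sum_empty, smul_zero, add_zero, sub_self, norm_zero] at hw'
      have : 0 < ε * (1 / 2) ^ k := by positivity
      linarith
    simp [this]
  | insert j s hj ih =>
    have key : ∀ m p : ℕ, ∀ᵐ x, x ∈ G → ∀ᶠ k in atTop,
        unitCube₀ ι (badSet f g (insert j s) k ((2 + Fintype.card ι) * (1 / (m + 1))) x)
          ≤ ((p : ENNReal) + 1)⁻¹ + ((p : ENNReal) + 1)⁻¹ := by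
      intro m p
      set ε : ℝ := 1 / (m + 1) with hε
      have hεpos : 0 < ε := by positivity
      set δ : ENNReal := ((p : ENNReal) + 1)⁻¹ with hδ
      have hδpos : 0 < δ := ENNReal.inv_pos.2 (by finiteness)
      set q := TopologicalSpace.denseSeq (ι → F)
      set A : ℕ → ℕ → Set (ι → ℝ) := fun i n =>
        (G ∩ {x | ‖g x - q i‖ < ε}) ∩ ⋂ k ≥ n, {x | unitCube₀ ι (badSet f g s k ε x) ≤ δ} with hAdef
      have hAm : ∀ i n, MeasurableSet (A i n) := fun i n =>
        (hG.inter (measurableSet_lt (hg.sub measurable_const).norm measurable_const)).inter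
          (MeasurableSet.iInter fun k => MeasurableSet.iInter fun _ =>
            measurableSet_le (measurable_measure_badSet hf hg s k ε) measurable_const)
      have hdens := ae_all_iff.2 fun i => ae_all_iff.2 fun n =>
        ae_tendsto_density_line (Pi.single j (1 : ℝ)) (hAm i n)
      filter_upwards [ih, hdens] with x hx hd hxG
      obtain ⟨i, hi⟩ := (TopologicalSpace.denseRange_denseSeq (ι → F)).exists_dist_lt (g x) hεpos
      rw [dist_eq_norm] at hi
      obtain ⟨n, hn⟩ := eventually_atTop.1 (ENNReal.tendsto_nhds_zero.1 (hx hxG ε hεpos) δ hδpos)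
      have hxA : x ∈ A i n := ⟨⟨hxG, hi⟩, mem_iInter₂.2 fun k hk => hn k hk⟩
      obtain ⟨η, hη, hηt⟩ := (hline x hxG j).exists_of_pos hεpos
      filter_upwards [eventually_ge_atTop n, ENNReal.tendsto_nhds_zero.1 (hd i n hxA) δ hδpos,
        tendsto_half_pow.eventually (gt_mem_nhds hη)] with k hk hk1 hk2
      refine measure_badSet_insert_le hf hg hj (A := A i n) ?_ ?_ hk1 ?_
      · intro x' hx' c
        have h1 : ‖g x' - q i‖ < ε := hx'.1.2
        calc ‖g x' c - g x c‖ = ‖(g x' - g x) c‖ := rfl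
          _ ≤ ‖g x' - g x‖ := norm_le_pi_norm _ c
          _ = ‖(g x' - q i) - (g x - q i)‖ := by congr 1; abel
          _ ≤ ‖g x' - q i‖ + ‖g x - q i‖ := norm_sub_le _ _
          _ ≤ 2 * ε := by linarith
      · intro x' hx'
        exact mem_iInter₂.1 hx'.2 k hk
      · have hρ : (0 : ℝ) < (1 / 2) ^ k := by positivity
        have hscale : ∀ᵐ t : ℝ, |(1 / 2 : ℝ) ^ k * t| < η →
            ‖f (x + ((1 / 2 : ℝ) ^ k * t) • Pi.single j (1 : ℝ)) - f x
              - ((1 / 2 : ℝ) ^ k * t) • g x j‖ ≤ ε * |(1 / 2 : ℝ) ^ k * t| := by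
          have hq : Measure.QuasiMeasurePreserving (fun t : ℝ => (1 / 2 : ℝ) ^ k * t) := by
            refine ⟨by fun_prop, ?_⟩
            rw [Real.map_volume_mul_left hρ.ne']
            exact Measure.smul_absolutelyContinuous
          exact hq.ae hηt
        filter_upwards [ae_restrict_of_ae (s := Metric.closedBall 0 (1 / 2)) hscale,
          ae_unitInterval₀_abs_le] with t ht ht'
        have habs : |(1 / 2 : ℝ) ^ k * t| ≤ (1 / 2) ^ k := by
          rw [abs_mul, abs_of_pos hρ]
          nlinarith
        exact (ht (habs.trans_lt hk2)).trans (by gcongr)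
    filter_upwards [ae_all_iff.2 fun m => ae_all_iff.2 fun p => key m p] with x hx hxG ε hε
    refine ENNReal.tendsto_nhds_zero.2 fun δ hδ => ?_
    have hN : (0 : ℝ) < 2 + Fintype.card ι := by positivity
    obtain ⟨m, hm⟩ := exists_nat_one_div_lt (div_pos hε hN)
    obtain ⟨p, hp⟩ := ENNReal.exists_inv_nat_lt (ENNReal.half_pos hδ.ne').ne'
    filter_upwards [hx m p hxG] with k hk
    have hle : ((p : ENNReal) + 1)⁻¹ ≤ δ / 2 := (ENNReal.inv_le_inv.2 le_self_add).trans hp.le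
    refine ((measure_mono (badSet_anti f g _ k ?_ x)).trans hk).trans
      ((add_le_add hle hle).trans (ENNReal.add_halves δ).le)
    rw [lt_div_iff₀ hN] at hm
    linarith

omit [MeasurableSpace F] [BorelSpace F] [SecondCountableTopology F] in
lemma notMem_badSet_univ {k : ℕ} {ε : ℝ} {x w : ι → ℝ} :
    w ∉ badSet f g Finset.univ k ε x ↔ ‖f (x + (1 / 2 : ℝ) ^ k • w) - f x
      - (1 / 2 : ℝ) ^ k • ∑ c, w c • g x c‖ ≤ ε * (1 / 2) ^ k := by
  have hsingle : ∑ c, w c • (Pi.single c (1 : ℝ) : ι → ℝ) = w := by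
    ext i
    simp [Finset.sum_apply, Pi.single_apply]
  rw [badSet, Set.mem_ofPred_eq, not_lt, hsingle]

/-- Two points at distance comparable to `2⁻ᵏ`, at both of which `f` is approximately linear at
this scale with nearly equal and invertible derivatives, are not brought together by `f`. -/
lemma norm_sub_ge_of_badSet (hf : Measurable f) (hg : Measurable g) {x y : ι → ℝ} {η : ℝ}
    (hη : 0 < η) {k : ℕ}
    (hgxy : ‖g x - g y‖ ≤ 2 * η)
    (hx : unitCube₀ ι (badSet f g Finset.univ k η x) < 2⁻¹ * (2⁻¹ : ENNReal) ^ Fintype.card ι)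
    (hy : unitCube₀ ι (badSet f g Finset.univ k η y) < 2⁻¹ * (2⁻¹ : ENNReal) ^ Fintype.card ι)
    (hxy : ‖y - x‖ ≤ (1 / 2) ^ k / 2)
    (hlow : (4 * (2 + Fintype.card ι) + 1) * η * ‖y - x‖ ≤ ‖∑ c, (y - x) c • g x c‖)
    (hxy' : (1 / 2) ^ k ≤ 4 * ‖y - x‖) :
    η * ‖y - x‖ ≤ ‖f y - f x‖ := by
  have hρ : (0 : ℝ) < (1 / 2) ^ k := by positivity
  set ρ : ℝ := (1 / 2) ^ k with hρdef
  set v : ι → ℝ := ρ⁻¹ • (y - x) with hv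
  have hvn : ‖v‖ ≤ 1 / 2 := by
    rw [hv, norm_smul, norm_inv, Real.norm_of_nonneg hρ.le, inv_mul_le_iff₀ hρ]
    linarith
  have hρv : ρ • v = y - x := by rw [hv, smul_inv_smul₀ hρ.ne']
  set Bx := badSet f g Finset.univ k η x
  set By := badSet f g Finset.univ k η y
  set Q : Set (ι → ℝ) := Metric.closedBall ((1 / 2 : ℝ) • v) (1 / 4) with hQ
  have hQv : volume Q = (2⁻¹ : ENNReal) ^ Fintype.card ι := by
    rw [hQ, Real.volume_pi_closedBall _ (by norm_num), ENNReal.ofReal_pow (by norm_num)]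
    congr 1
    rw [show (2 * (1 / 4) : ℝ) = 2⁻¹ by norm_num, ENNReal.ofReal_inv_of_pos (by norm_num)]
    simp
  have hvhalf : ‖(1 / 2 : ℝ) • v‖ ≤ 1 / 4 := by
    rw [norm_smul, Real.norm_of_nonneg (by norm_num)]
    linarith
  have hQx : ∀ w ∈ Q, ‖w‖ ≤ 1 / 2 := fun w hw => by
    have h1 : ‖w - (1 / 2 : ℝ) • v‖ ≤ 1 / 4 := by simpa [hQ, dist_eq_norm] using hw
    calc ‖w‖ = ‖(w - (1 / 2 : ℝ) • v) + (1 / 2 : ℝ) • v‖ := by simp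
      _ ≤ _ := norm_add_le _ _
      _ ≤ 1 / 2 := by linarith
  have hQy : ∀ w ∈ Q, ‖w - v‖ ≤ 1 / 2 := fun w hw => by
    have h1 : ‖w - (1 / 2 : ℝ) • v‖ ≤ 1 / 4 := by simpa [hQ, dist_eq_norm] using hw
    calc ‖w - v‖ = ‖(w - (1 / 2 : ℝ) • v) - (1 / 2 : ℝ) • v‖ := by
          congr 1
          rw [sub_sub, ← add_smul]
          norm_num
      _ ≤ _ := norm_sub_le _ _
      _ ≤ 1 / 2 := by linarith
  obtain ⟨w, hwQ, hwx, hwy⟩ : ∃ w ∈ Q, w ∉ Bx ∧ w - v ∉ By := by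
    by_contra! hcon
    have hsub : Q ⊆ (Bx ∩ Metric.closedBall 0 (1 / 2)) ∪
        (fun w => w - v) ⁻¹' (By ∩ Metric.closedBall 0 (1 / 2)) := by
      intro w hw
      by_cases h : w ∈ Bx
      · exact Or.inl ⟨h, by simpa using hQx w hw⟩
      · exact Or.inr ⟨hcon w hw h, by simpa using hQy w hw⟩
    have h1 := (measure_mono (μ := volume) hsub).trans (measure_union_le _ _)
    rw [hQv, (measurePreserving_sub_right volume v).measure_preimage
      ((measurableSet_badSet hf hg _ k η y).inter
        Metric.isClosed_closedBall.measurableSet).nullMeasurableSet] at h1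
    rw [unitCube₀_eq, Measure.restrict_apply' Metric.isClosed_closedBall.measurableSet] at hx hy
    have h2 := h1.trans_lt (ENNReal.add_lt_add hx hy)
    rw [← add_mul, ENNReal.inv_two_add_inv_two, one_mul] at h2
    exact lt_irrefl _ h2
  have hwx' := notMem_badSet_univ.1 hwx
  have hwy' := notMem_badSet_univ.1 hwy
  rw [← hρdef] at hwx' hwy'
  have hz : y + ρ • (w - v) = x + ρ • w := by
    rw [smul_sub, hρv]; abel
  rw [hz] at hwy'
  have hsum : ‖∑ c, (w - v) c • (g x c - g y c)‖ ≤ Fintype.card ι * η := by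
    refine (norm_sum_le_of_le Finset.univ (f := fun c => (w - v) c • (g x c - g y c))
      (n := fun _ => η) fun c _ => ?_).trans ?_
    · rw [norm_smul]
      calc ‖(w - v) c‖ * ‖g x c - g y c‖ ≤ 1 / 2 * (2 * η) :=
            mul_le_mul ((norm_le_pi_norm _ c).trans (hQy w hwQ))
              ((norm_le_pi_norm (g x - g y) c).trans hgxy) (norm_nonneg _) (by norm_num)
        _ = η := by ring
    · rw [Finset.sum_const, nsmul_eq_mul, Finset.card_univ]
  have hlin : ∑ c, (y - x) c • g x c = ρ • ∑ c, w c • g x c - ρ • ∑ c, (w - v) c • g x c := by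
    rw [← smul_sub, ← Finset.sum_sub_distrib, ← hρv, Finset.smul_sum]
    refine Finset.sum_congr rfl fun c _ => ?_
    simp [sub_smul, smul_smul]
  have hdecomp : ∑ c, (y - x) c • g x c = (f y - f x)
      - (f (x + ρ • w) - f x - ρ • ∑ c, w c • g x c)
      + (f (x + ρ • w) - f y - ρ • ∑ c, (w - v) c • g y c)
      - ρ • ∑ c, (w - v) c • (g x c - g y c) := by
    rw [hlin]
    simp only [smul_sub, Finset.sum_sub_distrib]
    abel
  have hn1 := norm_sub_le ((f y - f x)
      - (f (x + ρ • w) - f x - ρ • ∑ c, w c • g x c)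
      + (f (x + ρ • w) - f y - ρ • ∑ c, (w - v) c • g y c))
      (ρ • ∑ c, (w - v) c • (g x c - g y c))
  have hn2 := norm_add_le ((f y - f x)
      - (f (x + ρ • w) - f x - ρ • ∑ c, w c • g x c))
      (f (x + ρ • w) - f y - ρ • ∑ c, (w - v) c • g y c)
  have hn3 := norm_sub_le (f y - f x) (f (x + ρ • w) - f x - ρ • ∑ c, w c • g x c)
  rw [← hdecomp, norm_smul, Real.norm_of_nonneg hρ.le] at hn1
  have hmain : (4 * (2 + Fintype.card ι) + 1) * η * ‖y - x‖
      ≤ ‖f y - f x‖ + (2 + Fintype.card ι) * η * ρ := by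
    nlinarith [mul_le_mul_of_nonneg_left hsum hρ.le]
  have hN : 0 ≤ (2 + Fintype.card ι : ℝ) * η := by positivity
  nlinarith [mul_le_mul_of_nonneg_left hxy' hN]

omit [DecidableEq ι] in
lemma volume_inter_preimage_eq_zero_of_norm_le {f : (ι → ℝ) → ι → ℝ} {S N : Set (ι → ℝ)} {η : ℝ}
    (hη : 0 < η) (h : ∀ x ∈ S, ∀ y ∈ S, η * ‖y - x‖ ≤ ‖f y - f x‖) (hN : volume N = 0) :
    volume (S ∩ f ⁻¹' N) = 0 := by
  have hanti : AntilipschitzWith (Real.toNNReal η⁻¹) (fun x : S => f x) := by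
    refine AntilipschitzWith.of_le_mul_dist fun x y => ?_
    rw [Real.coe_toNNReal _ (inv_nonneg.2 hη.le), Subtype.dist_eq, dist_eq_norm, dist_eq_norm,
      ← div_eq_inv_mul, le_div_iff₀ hη, mul_comm]
    exact h y y.2 x x.2
  have h0 : (0 : ℝ) ≤ Fintype.card ι := by positivity
  have h1 := hanti.hausdorffMeasure_preimage_le h0 N
  have h2 := (isometry_subtype_coe (s := S)).hausdorffMeasure_image (Or.inl h0)
    ((fun x : S => f x) ⁻¹' N)
  rw [hausdorffMeasure_pi_real, hN, mul_zero, nonpos_iff_eq_zero] at h1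
  rw [hausdorffMeasure_pi_real, h1] at h2
  convert h2 using 2
  ext x
  simp [and_comm]

lemma exists_pos_mul_norm_le_of_det_ne_zero {A : ι → ι → ℝ}
    (hA : (Matrix.of fun a c => A c a).det ≠ 0) :
    ∃ κ > 0, ∀ v : ι → ℝ, κ * ‖v‖ ≤ ‖∑ c, v c • A c‖ := by
  obtain ⟨K, hK, hanti⟩ := (Matrix.mulVecLin (Matrix.of fun a c => A c a)).exists_antilipschitzWith
    (LinearMap.ker_eq_bot'.2 fun v hv => Matrix.eq_zero_of_mulVec_eq_zero hA hv)
  refine ⟨(K : ℝ)⁻¹, by positivity, fun v => ?_⟩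
  have h := hanti.le_mul_dist v 0
  rw [map_zero, dist_zero_right, dist_zero_right] at h
  rw [inv_mul_le_iff₀ (by positivity)]
  have hsum : ∑ c, v c • A c = (Matrix.mulVecLin (Matrix.of fun a c => A c a)) v := by
    ext a
    simp [Matrix.mulVec, dotProduct, mul_comm]
  rw [hsum]
  exact h

/-- A map with partial derivatives at the points of `G` sends almost no point of `G` with
invertible derivative into a given null set. -/
theorem ae_notMem_null_of_det_ne_zero {f : (ι → ℝ) → ι → ℝ} {g : (ι → ℝ) → ι → ι → ℝ}
    (hf : Measurable f) (hg : Measurable g) {G : Set (ι → ℝ)} (hG : MeasurableSet G)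
    (hline : ∀ x ∈ G, ∀ c, LineDiff f (Pi.single c (1 : ℝ)) (g x c) x)
    {N : Set (ι → ℝ)} (hN : volume N = 0) :
    ∀ᵐ x, x ∈ G → (Matrix.of fun a c => g x c a).det ≠ 0 → f x ∉ N := by
  set K : ℝ := 4 * (2 + Fintype.card ι) + 1 with hK
  have hKpos : 0 < K := by positivity
  set β : ENNReal := 2⁻¹ * (2⁻¹ : ENNReal) ^ Fintype.card ι with hβ
  have hβpos : 0 < β := ENNReal.mul_pos (by simp) (by simp)
  set q := TopologicalSpace.denseSeq (ι → ι → ℝ)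
  set z := TopologicalSpace.denseSeq (ι → ℝ)
  let S : ℕ → ℕ → ℕ → ℕ → Set (ι → ℝ) := fun p i n l =>
    {x | ‖g x - q i‖ < 1 / (p + 1) ∧ (∀ v : ι → ℝ, K * (1 / (p + 1)) * ‖v‖ ≤ ‖∑ c, v c • g x c‖) ∧
      (∀ k ≥ n, unitCube₀ ι (badSet f g Finset.univ k (1 / (p + 1)) x) < β) ∧
      ‖x - z l‖ < (1 / 2) ^ n / 4}
  have hS : ∀ p i n l, ∀ᵐ x, x ∈ S p i n l → f x ∉ N := by
    intro p i n l
    have hη : (0 : ℝ) < 1 / (p + 1) := by positivity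
    have hzero := volume_inter_preimage_eq_zero_of_norm_le (f := f) (S := S p i n l) hη ?_ hN
    · rw [ae_iff]
      convert hzero using 2
      ext x
      simp
    · rintro x ⟨hx1, hx2, hx3, hx4⟩ y ⟨hy1, -, hy3, hy4⟩
      rcases eq_or_ne y x with rfl | hne
      · simp
      have hpos : 0 < ‖y - x‖ := norm_pos_iff.2 (sub_ne_zero.2 hne)
      have hclose : ‖y - x‖ < (1 / 2) ^ n / 2 := by
        have := norm_sub_le (y - z l) (x - z l)
        rw [sub_sub_sub_cancel_right] at this
        linarith
      have hn1 : ((1 : ℝ) / 2) ^ n ≤ 1 := pow_le_one₀ (by norm_num) (by norm_num)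
      obtain ⟨k, hk1, hk2⟩ := exists_nat_pow_near_of_lt_one (x := 2 * ‖y - x‖) (y := (1 / 2 : ℝ))
        (by positivity) (by linarith) (by norm_num) (by norm_num)
      have hkn : n ≤ k := by
        have : ((1 : ℝ) / 2) ^ (k + 1) < (1 / 2) ^ n := hk1.trans (by linarith)
        have := (pow_lt_pow_iff_right_of_lt_one₀ (by norm_num) (by norm_num)).1 this
        omega
      refine norm_sub_ge_of_badSet hf hg hη ?_ (hx3 k hkn) (hy3 k hkn) (by linarith) (hx2 _) ?_
      · have := norm_sub_le (g x - q i) (g y - q i)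
        rw [sub_sub_sub_cancel_right] at this
        linarith
      · rw [pow_succ] at hk1
        linarith
  filter_upwards [ae_tendsto_measure_badSet hf hg hG hline Finset.univ,
    ae_all_iff.2 fun p => ae_all_iff.2 fun i => ae_all_iff.2 fun n => ae_all_iff.2 fun l =>
      hS p i n l] with x hx hxS hxG hdet
  obtain ⟨κ, hκ, hlow⟩ := exists_pos_mul_norm_le_of_det_ne_zero hdet
  obtain ⟨p, hp⟩ := exists_nat_one_div_lt (div_pos hκ hKpos)
  have hη : (0 : ℝ) < 1 / (p + 1) := by positivity
  obtain ⟨i, hi⟩ := (TopologicalSpace.denseRange_denseSeq (ι → ι → ℝ)).exists_dist_lt (g x) hη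
  obtain ⟨n, hn⟩ := eventually_atTop.1 ((hx hxG _ hη).eventually (gt_mem_nhds hβpos))
  obtain ⟨l, hl⟩ := (TopologicalSpace.denseRange_denseSeq (ι → ℝ)).exists_dist_lt x
    (show (0 : ℝ) < (1 / 2) ^ n / 4 by positivity)
  rw [dist_eq_norm] at hi hl
  refine hxS p i n l ⟨hi, fun v => ?_, hn, hl⟩
  rw [lt_div_iff₀ hKpos] at hp
  exact (mul_le_mul_of_nonneg_right (by linarith) (norm_nonneg v)).trans (hlow v)

end ApproximateDifferentiability

section Sections

lemma isOpen_Rset (ρ : ℝ → ℝ) : IsOpen (Rset ρ) := by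
  refine Metric.isOpen_iff.2 fun t ht => ?_
  obtain ⟨ε, hε, hint⟩ := ht
  refine ⟨ε / 2, by positivity, fun s hs => ⟨ε / 2, by positivity, hint.mono_set ?_⟩⟩
  rw [Metric.mem_ball, Real.dist_eq, abs_lt] at hs
  exact Ioo_subset_Ioo (by linarith) (by linarith)

lemma ae_hasDerivAt_of_forall_integral {R : Set ℝ} (hR : IsOpen R) {v g : ℝ → ℝ}
    (h : ∀ a b : ℝ, a ≤ b → Icc a b ⊆ R →
      IntegrableOn g (Icc a b) volume ∧ v b - v a = ∫ s in a..b, g s) :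
    ∀ᵐ s : ℝ, s ∈ R → HasDerivAt v (g s) s := by
  have key : ∀ p q : ℚ, ∀ᵐ s : ℝ, p < s → s < q → Icc (p : ℝ) q ⊆ R → HasDerivAt v (g s) s := by
    intro p q
    by_cases hpq : (p : ℝ) ≤ q ∧ Icc (p : ℝ) q ⊆ R
    · obtain ⟨hle, hsub⟩ := hpq
      have hint : IntervalIntegrable g volume p q :=
        (intervalIntegrable_iff_integrableOn_Icc_of_le hle).2 (h p q hle hsub).1
      filter_upwards [hint.ae_hasDerivAt_integral] with s hs hps hsq _
      have hd := (hs (by rw [uIcc_of_le hle]; exact ⟨hps.le, hsq.le⟩) p left_mem_uIcc).const_add (v p)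
      refine hd.congr_of_eventuallyEq ?_
      filter_upwards [Ioo_mem_nhds hps hsq] with y hy
      rw [← (h p y hy.1.le ((Icc_subset_Icc_right hy.2.le).trans hsub)).2]
      ring
    · refine Eventually.of_forall fun s hps hsq hsub => absurd ⟨(hps.trans hsq).le, hsub⟩ hpq
  filter_upwards [ae_all_iff.2 fun p => ae_all_iff.2 fun q => key p q] with s hs hsR
  obtain ⟨ε, hε, hball⟩ := Metric.isOpen_iff.1 hR s hsR
  obtain ⟨p, hp1, hp2⟩ := exists_rat_btwn (show s - ε < s by linarith)
  obtain ⟨q, hq1, hq2⟩ := exists_rat_btwn (show s < s + ε by linarith)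
  refine hs p q hp2 hq1 fun y hy => hball ?_
  rw [Metric.mem_ball, Real.dist_eq, abs_lt]
  constructor <;> linarith [hy.1, hy.2]

lemma lineDiff_of_hasDerivAt {R : Set ℝ} (hR : IsOpen R) {u v : ℝ → ℝ} {g s : ℝ}
    (huv : ∀ᵐ y : ℝ, y ∈ R → v y = u y) (hs : s ∈ R) (hvs : v s = u s) (hd : HasDerivAt v g s) :
    LineDiff u (1 : ℝ) g s := by
  intro m
  have hlin : ∀ᶠ t in 𝓝 (0 : ℝ), ‖v (s + t) - v s - t • g‖ ≤ 1 / (m + 1) * ‖t‖ :=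
    (hasDerivAt_iff_isLittleO_nhds_zero.1 hd).bound (by positivity)
  have hmem : ∀ᶠ t in 𝓝 (0 : ℝ), s + t ∈ R := by
    have : Tendsto (fun t : ℝ => s + t) (𝓝 0) (𝓝 s) := by
      simpa using (continuous_const_add s).tendsto (0 : ℝ)
    exact this.eventually (hR.mem_nhds hs)
  obtain ⟨δ, hδ, hball⟩ := Metric.eventually_nhds_iff.1 (hlin.and hmem)
  obtain ⟨n, hn⟩ := exists_nat_one_div_lt hδ
  refine ⟨n, ?_⟩
  filter_upwards [(measurePreserving_add_left (volume : Measure ℝ) s).quasiMeasurePreserving.ae huv]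
    with t ht htn
  obtain ⟨h1, h2⟩ := hball (y := t) (by simpa [Real.dist_eq] using htn.trans hn)
  rw [smul_eq_mul, mul_one, ← ht h2, ← hvs]
  exact h1

lemma update_add_eq {ι : Type*} [DecidableEq ι] (x : ι → ℝ) (j : ι) (t : ℝ) :
    Function.update x j (x j + t) = x + t • Pi.single j (1 : ℝ) := by
  ext i
  by_cases h : i = j
  · subst h; simp
  · simp [h]

lemma ae_integrable_update {r : ℕ} {k : (Fin r → ℝ) → ℝ} (hk : Integrable k) (j : Fin r) :
    ∀ᵐ y : Fin r → ℝ, Integrable fun s : ℝ => k (Function.update y j s) := by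
  obtain _ | n := r
  · exact j.elim0
  have hmp := volume_preserving_piFinSuccAbove (fun _ : Fin (n + 1) => ℝ) j
  have hint := (hmp.symm.integrable_comp_emb (MeasurableEquiv.measurableEmbedding _)).2 hk
  have hsnd := (Measure.quasiMeasurePreserving_snd.comp hmp.quasiMeasurePreserving).ae
    hint.prod_left_ae
  filter_upwards [hsnd] with y hy
  have heq : (fun s : ℝ => k (Function.update y j s)) = fun s : ℝ =>
      k ((MeasurableEquiv.piFinSuccAbove (fun _ : Fin (n + 1) => ℝ) j).symm
        (s, (MeasurableEquiv.piFinSuccAbove (fun _ : Fin (n + 1) => ℝ) j y).2)) := by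
    funext s
    congr 1
    exact (Fin.insertNth_removeNth j s y).symm
  rw [heq]
  exact hy

lemma lineDiff_of_lineDiff_update {ι : Type*} [DecidableEq ι] {u : (ι → ℝ) → ℝ} {x : ι → ℝ}
    {j : ι} {s g : ℝ} (h : LineDiff (fun s => u (Function.update x j s)) (1 : ℝ) g s) :
    LineDiff u (Pi.single j (1 : ℝ)) g (Function.update x j s) := by
  intro m
  obtain ⟨n, hn⟩ := h m
  refine ⟨n, ?_⟩
  filter_upwards [hn] with t ht
  have := update_add_eq (Function.update x j s) j t
  rw [Function.update_self, Function.update_idem] at this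
  simpa [← this] using ht

variable {r : ℕ} {k : (Fin r → ℝ) → ℝ} {ξ : Fin r → Fin r → (Fin r → ℝ) → ℝ}

/-- Functions of the domain have the prescribed partial derivatives, along almost every line and
at almost every point charged by `k`. -/
lemma MemDom.ae_lineDiff (hHG : HG r k ξ) (hk : Integrable k) {u : (Fin r → ℝ) → ℝ}
    {du : Fin r → (Fin r → ℝ) → ℝ} (hu : MemDom r k ξ u du) (j : Fin r) :
    ∀ᵐ y, k y ≠ 0 → LineDiff u (Pi.single j (1 : ℝ)) (du j y) y := by
  set D : Set (Fin r → ℝ) :=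
    {y | k y = 0}ᶜ ∩ {y | LineDiff u (Pi.single j (1 : ℝ)) (du j y) y}ᶜ with hD
  have hDm : MeasurableSet D :=
    (hHG.k_meas (measurableSet_singleton 0)).compl.inter
      (measurableSet_lineDiff hu.meas (hu.du_meas j) _).compl
  filter_upwards [ae_notMem_of_lines (Pi.single j (1 : ℝ)) hDm, hHG.hamza j, hu.sectionsAC j,
    ae_integrable_update hk j] with y hy hhamza hsec hint hky
  by_contra hcon
  refine hy ?_ ⟨hky, hcon⟩
  set R := Rset fun t => k (Function.update y j t)
  have hR : ∀ᵐ s : ℝ, k (Function.update y j s) ≠ 0 → s ∈ R := by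
    by_cases hpos : 0 < ∫ s : ℝ, k (Function.update y j s)
    · filter_upwards [hhamza hpos] with s hs hne
      by_contra hc
      exact hne (hs hc)
    · have hnn : 0 ≤ fun s : ℝ => k (Function.update y j s) := fun s => hHG.k_nonneg _
      have h0 := (integral_eq_zero_iff_of_nonneg hnn hint).1
        (le_antisymm (not_lt.1 hpos) (integral_nonneg hnn))
      filter_upwards [h0] with s hs hne
      exact absurd hs hne
  obtain ⟨v, hvu, hv⟩ := hsec
  have hRo : IsOpen R := isOpen_Rset _
  have hline : ∀ᵐ s : ℝ, Function.update y j s ∉ D := by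
    filter_upwards [hR, hvu, ae_hasDerivAt_of_forall_integral hRo hv] with s hs1 hs2 hs3 hsD
    have hsR := hs1 hsD.1
    exact hsD.2 (lineDiff_of_lineDiff_update (lineDiff_of_hasDerivAt hRo hvu hsR (hs2 hsR) (hs3 hsR)))
  filter_upwards [(measurePreserving_add_left (volume : Measure ℝ) (y j)).quasiMeasurePreserving.ae
    hline] with t ht
  rwa [update_add_eq] at ht

end Sections

section InfiniteProduct

variable {ι κ : Type*} [DecidableEq ι] [DecidableEq κ]

/-- The coordinate vector of `ι → κ → ℝ` in the direction of coordinate `j` of block `i`. -/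
def coordVec (i : ι) (j : κ) : ι → κ → ℝ := Pi.single i (Pi.single j (1 : ℝ))

lemma update_add_smul_single (x : ι → κ → ℝ) (i : ι) (j : κ) (y : κ → ℝ) (t : ℝ) :
    Function.update x i (y + t • Pi.single j (1 : ℝ)) =
      Function.update x i y + t • coordVec i j := by
  ext i' j'
  by_cases h : i' = i
  · subst h; simp [coordVec]
  · simp [coordVec, h]

omit [DecidableEq ι] [DecidableEq κ] in
lemma measurable_add_smul (e : ι → κ → ℝ) :
    Measurable fun z : (ι → κ → ℝ) × ℝ => z.1 + z.2 • e := by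
  refine measurable_pi_iff.2 fun i => measurable_pi_iff.2 fun j => ?_
  simp only [Pi.add_apply, Pi.smul_apply]
  fun_prop

section Update

variable {X : ι → Type*} [∀ i, MeasurableSpace (X i)] (μ : ∀ i, Measure (X i))
  [∀ i, IsProbabilityMeasure (μ i)]

lemma ae_infinitePi_of_ae_update (i : ι) {p : (∀ i, X i) → Prop} (hp : MeasurableSet {x | p x})
    (h : ∀ᵐ x ∂Measure.infinitePi μ, ∀ᵐ y ∂μ i, p (Function.update x i y)) :
    ∀ᵐ x ∂Measure.infinitePi μ, p x := by
  have hmp := measurePreserving_update_infinitePi μ i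
  rw [← hmp.map_eq, ae_map_iff hmp.measurable.aemeasurable hp]
  exact (Measure.ae_prod_iff_ae_ae (hmp.measurable hp)).2 h

lemma ae_update_of_ae_infinitePi (i : ι) {p : (∀ i, X i) → Prop}
    (h : ∀ᵐ x ∂Measure.infinitePi μ, p x) :
    ∀ᵐ x ∂Measure.infinitePi μ, ∀ᵐ y ∂μ i, p (Function.update x i y) :=
  Measure.ae_ae_of_ae_prod ((measurePreserving_update_infinitePi μ i).quasiMeasurePreserving.ae h)

lemma lintegral_infinitePi_update (i : ι) {f : (∀ i, X i) → ENNReal} (hf : Measurable f) :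
    ∫⁻ x, f x ∂Measure.infinitePi μ =
      ∫⁻ x, ∫⁻ y, f (Function.update x i y) ∂μ i ∂Measure.infinitePi μ := by
  have hmp := measurePreserving_update_infinitePi μ i
  rw [← hmp.lintegral_comp hf]
  exact lintegral_prod _ (hf.comp hmp.measurable).aemeasurable

end Update

variable [Fintype κ] {ν : ι → Measure (κ → ℝ)} [∀ i, IsProbabilityMeasure (ν i)]

lemma ae_notMem_of_lines_infinitePi (hν : ∀ i, ν i ≪ volume) (i : ι) (j : κ)
    {D : Set (ι → κ → ℝ)} (hD : MeasurableSet D)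
    (h : ∀ᵐ x ∂Measure.infinitePi ν,
      ∀ᵐ t : ℝ, x + t • coordVec i j ∉ D) :
    ∀ᵐ x ∂Measure.infinitePi ν, x ∉ D := by
  refine ae_infinitePi_of_ae_update ν i hD.compl ?_
  filter_upwards [ae_update_of_ae_infinitePi ν i h] with x hx
  have hDx : MeasurableSet {y | Function.update x i y ∈ D} := measurable_update x hD
  filter_upwards [hx, (hν i).ae_le (ae_notMem_of_lines (Pi.single j (1 : ℝ)) hDx)] with y hy hyD
  refine hyD ?_
  filter_upwards [hy] with t ht
  rwa [update_add_smul_single]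

/-- A measurable set is negligible for the product of absolutely continuous laws as soon as all
its slices by finite-dimensional coordinate subspaces in fixed directions are. -/
lemma ae_notMem_of_slices_infinitePi (hν : ∀ i, ν i ≪ volume) {d : ℕ} (c : Fin d → ι × κ)
    {D : Set (ι → κ → ℝ)} (hD : MeasurableSet D)
    (h : ∀ x, ∀ᵐ s : Fin d → ℝ,
      x + ∑ b, s b • coordVec (c b).1 (c b).2 ∉ D) :
    ∀ᵐ x ∂Measure.infinitePi ν, x ∉ D := by
  induction d generalizing D with
  | zero =>
    refine Eventually.of_forall fun x => ?_
    obtain ⟨s, hs⟩ := (h x).exists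
    simpa using hs
  | succ d ih =>
    refine ae_notMem_of_lines_infinitePi hν (c 0).1 (c 0).2 hD ?_
    set e := coordVec (c 0).1 (c 0).2
    have hm : MeasurableSet {x | ∀ᵐ t : ℝ, x + t • e ∉ D} :=
      measurableSet_ae_right (measurable_add_smul e hD.compl)
    have key := ih (fun b => c b.succ) hm.compl fun x => ?_
    · filter_upwards [key] with x hx
      exact not_not.1 hx
    · have hmp := (volume_preserving_piFinSuccAbove (fun _ : Fin (d + 1) => ℝ) 0).symm
      have h1 := hmp.quasiMeasurePreserving.ae (h x)
      have h2 := Measure.ae_ae_of_ae_prod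
        (Measure.measurePreserving_swap.quasiMeasurePreserving.ae h1)
      filter_upwards [h2] with s hs
      rw [Set.mem_compl_iff, not_not]
      filter_upwards [hs] with t ht
      convert ht using 1
      rw [Fin.sum_univ_succ, add_assoc, add_comm (∑ b, _)]
      rfl

end InfiniteProduct

section GramDeterminant

lemma exists_det_ne_zero_of_det_gram {ι κ : Type*} [Fintype κ] {d : ℕ} {ξ : ι → κ → κ → ℝ}
    {V : Fin d → ι → κ → ℝ}
    (hsum : ∀ a b, Summable fun i => ∑ j, ∑ l, ξ i j l * V a i j * V b i l)
    (hdet : (Matrix.of fun a b : Fin d => ∑' i, ∑ j, ∑ l, ξ i j l * V a i j * V b i l).det ≠ 0) :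
    ∃ c : Fin d → ι × κ, (Matrix.of fun a b : Fin d => V a (c b).1 (c b).2).det ≠ 0 := by
  set w : ι × κ → Fin d → ℝ := fun c a => V a c.1 c.2 with hw
  have hspan : Submodule.span ℝ (range w) = ⊤ := by
    by_contra hne
    obtain ⟨φ, hφ, hker⟩ := Submodule.exists_le_ker_of_lt_top _ (lt_top_iff_ne_top.2 hne)
    have hφw : ∀ v : Fin d → ℝ, φ v = ∑ a, φ (Pi.single a 1) * v a := fun v => by
      conv_lhs => rw [pi_eq_sum_univ' v]
      simp [mul_comm]
    have hzero : ∀ i j, ∑ a, φ (Pi.single a 1) * V a i j = 0 := fun i j => by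
      rw [← hφw (w (i, j))]
      exact hker (Submodule.subset_span (mem_range_self _))
    refine hdet (Matrix.exists_vecMul_eq_zero_iff.1 ⟨fun a => φ (Pi.single a 1), ?_, ?_⟩)
    · intro h0
      refine hφ (LinearMap.ext fun v => ?_)
      rw [hφw]
      simp [fun a => congrFun h0 a]
    · ext b
      simp only [Matrix.vecMul, dotProduct, Matrix.of_apply, Pi.zero_apply]
      simp_rw [← tsum_mul_left]
      rw [← Summable.tsum_finsetSum fun a _ => (hsum a b).mul_left _]
      convert tsum_zero with i
      simp_rw [Finset.mul_sum]
      rw [Finset.sum_comm]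
      refine Finset.sum_eq_zero fun j _ => ?_
      rw [Finset.sum_comm]
      refine Finset.sum_eq_zero fun l _ => ?_
      calc _ = ξ i j l * V b i l * ∑ a, φ (Pi.single a 1) * V a i j := by
            rw [Finset.mul_sum]
            exact Finset.sum_congr rfl fun a _ => by ring
        _ = 0 := by rw [hzero, mul_zero]
  obtain ⟨v, hv, -, hli⟩ := Submodule.exists_fun_fin_finrank_span_eq ℝ (range w)
  have hrank : d = Module.finrank ℝ (Submodule.span ℝ (range w)) := by
    rw [hspan, finrank_top, Module.finrank_fin_fun]
  choose c hc using hv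
  refine ⟨fun b => c (finCongr hrank b), ?_⟩
  have hli' := hli.comp _ (finCongr hrank).injective
  rw [← Matrix.det_transpose]
  have := (Matrix.linearIndependent_rows_iff_isUnit
    (A := Matrix.of (v ∘ finCongr hrank))).1 hli'
  rw [Matrix.isUnit_iff_isUnit_det, isUnit_iff_ne_zero] at this
  convert this using 3
  ext b a
  simp [← hc, hw]

end GramDeterminant

section ProductStructure

variable {r : ℕ}

lemma isProbabilityMeasure_withDensity_ofReal {k : (Fin r → ℝ) → ℝ} (hnn : ∀ y, 0 ≤ k y)
    (hk : ∫ y, k y = 1) :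
    IsProbabilityMeasure (volume.withDensity fun y => ENNReal.ofReal (k y)) := by
  refine ⟨?_⟩
  rw [withDensity_apply _ MeasurableSet.univ, Measure.restrict_univ,
    ← ofReal_integral_eq_lintegral_ofReal (integrable_of_integral_eq_one hk)
    (Eventually.of_forall hnn), hk, ENNReal.ofReal_one]

lemma HG.ae_nonneg {k : (Fin r → ℝ) → ℝ} {ξ : Fin r → Fin r → (Fin r → ℝ) → ℝ}
    (h : HG r k ξ) : ∀ᵐ y, ∀ v : Fin r → ℝ, 0 ≤ ∑ i, ∑ j, ξ i j y * v i * v j := by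
  obtain ⟨O, -, hO, hell⟩ := h.elliptic
  have : ∀ᵐ y, y ∈ O := by
    rw [ae_iff]
    exact hO
  filter_upwards [this] with y hy v
  obtain ⟨c, hc, hcv⟩ := hell {y} (singleton_subset_iff.2 hy) isCompact_singleton
  refine le_trans ?_ (hcv y rfl v)
  positivity

lemma MemDom.lintegral_eq {k : (Fin r → ℝ) → ℝ} {ξ : Fin r → Fin r → (Fin r → ℝ) → ℝ}
    (h : HG r k ξ) {u : (Fin r → ℝ) → ℝ} {du : Fin r → (Fin r → ℝ) → ℝ} (hu : MemDom r k ξ u du) :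
    ∫⁻ y, ENNReal.ofReal (∑ i, ∑ j, ξ i j y * du i y * du j y)
        ∂(volume.withDensity fun y => ENNReal.ofReal (k y)) =
      2 * ENNReal.ofReal (energy r k ξ du) := by
  have hξ := h.xi_meas
  have hdu := hu.du_meas
  have hq : Measurable fun y => ∑ i, ∑ j, ξ i j y * du i y * du j y := by fun_prop
  rw [lintegral_withDensity_eq_lintegral_mul _ h.k_meas.ennreal_ofReal hq.ennreal_ofReal,
    energy, ENNReal.ofReal_mul (by norm_num), ← mul_assoc,
    ofReal_integral_eq_lintegral_ofReal hu.energyInt]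
  · rw [ENNReal.ofReal_div_of_pos two_pos, ENNReal.ofReal_one, ENNReal.ofReal_ofNat, one_div,
      ENNReal.mul_inv_cancel (by simp) (by simp), one_mul]
    refine lintegral_congr fun y => ?_
    rw [Pi.mul_apply, mul_comm, ENNReal.ofReal_mul' (h.k_nonneg y)]
  · filter_upwards [h.ae_nonneg] with y hy
    exact mul_nonneg (hy fun i => du i y) (h.k_nonneg y)

lemma summable_bilin_of_summable_quad {ι κ : Type*} [Fintype κ] {ξ : ι → κ → κ → ℝ}
    (hsymm : ∀ i j l, ξ i j l = ξ i l j)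
    (hnn : ∀ i, ∀ v : κ → ℝ, 0 ≤ ∑ j, ∑ l, ξ i j l * v j * v l) {v w : ι → κ → ℝ}
    (hv : Summable fun i => ∑ j, ∑ l, ξ i j l * v i j * v i l)
    (hw : Summable fun i => ∑ j, ∑ l, ξ i j l * w i j * w i l) :
    Summable fun i => ∑ j, ∑ l, ξ i j l * v i j * w i l := by
  refine Summable.of_norm_bounded (hv.add hw) fun i => ?_
  have hcomm : ∑ j, ∑ l, ξ i j l * w i j * v i l = ∑ j, ∑ l, ξ i j l * v i j * w i l := by
    rw [Finset.sum_comm]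
    refine Finset.sum_congr rfl fun j _ => Finset.sum_congr rfl fun l _ => ?_
    rw [hsymm]
    ring
  have hadd : ∑ j, ∑ l, ξ i j l * (v i j + w i j) * (v i l + w i l) =
      (∑ j, ∑ l, ξ i j l * v i j * v i l) + (∑ j, ∑ l, ξ i j l * w i j * w i l) +
        (∑ j, ∑ l, ξ i j l * v i j * w i l) + ∑ j, ∑ l, ξ i j l * w i j * v i l := by
    simp only [← Finset.sum_add_distrib]
    refine Finset.sum_congr rfl fun j _ => Finset.sum_congr rfl fun l _ => by ring
  have hsub : ∑ j, ∑ l, ξ i j l * (v i j - w i j) * (v i l - w i l) =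
      (∑ j, ∑ l, ξ i j l * v i j * v i l) + (∑ j, ∑ l, ξ i j l * w i j * w i l) -
        (∑ j, ∑ l, ξ i j l * v i j * w i l) - ∑ j, ∑ l, ξ i j l * w i j * v i l := by
    simp only [← Finset.sum_add_distrib, ← Finset.sum_sub_distrib]
    refine Finset.sum_congr rfl fun j _ => Finset.sum_congr rfl fun l _ => by ring
  have h1 := hnn i fun j => v i j + w i j
  have h2 := hnn i fun j => v i j - w i j
  have h3 := hnn i (v i)
  have h4 := hnn i (w i)
  rw [hadd] at h1
  rw [hsub] at h2
  rw [Real.norm_eq_abs, abs_le]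
  constructor <;> linarith

variable {k : ℕ → (Fin r → ℝ) → ℝ} {ξ : ℕ → Fin r → Fin r → (Fin r → ℝ) → ℝ}

/-- The law with density `k i` of the `i`-th block of coordinates. -/
def blockLaw (k : ℕ → (Fin r → ℝ) → ℝ) (i : ℕ) : Measure (Fin r → ℝ) :=
  volume.withDensity fun y => ENNReal.ofReal (k i y)

lemma blockLaw_absolutelyContinuous (i : ℕ) : blockLaw k i ≪ volume :=
  withDensity_absolutelyContinuous _ _

variable [∀ i, IsProbabilityMeasure (blockLaw k i)]

lemma ae_nonneg_infinitePi (hHG : ∀ i, HG r (k i) (ξ i)) :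
    ∀ᵐ x ∂Measure.infinitePi (blockLaw k), ∀ i, ∀ v : Fin r → ℝ,
      0 ≤ ∑ j, ∑ l, ξ i j l (x i) * v j * v l :=
  ae_all_iff.2 fun i => (measurePreserving_eval_infinitePi (blockLaw k) i).quasiMeasurePreserving.ae
    ((blockLaw_absolutelyContinuous i).ae_le (hHG i).ae_nonneg)

variable {U : (ℕ → Fin r → ℝ) → ℝ} {dU : ℕ → Fin r → (ℕ → Fin r → ℝ) → ℝ}

lemma MemDomInfProd.ae_summable (hHG : ∀ i, HG r (k i) (ξ i))
    (hU : MemDomInfProd r k ξ (Measure.infinitePi (blockLaw k)) U dU) :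
    ∀ᵐ x ∂Measure.infinitePi (blockLaw k),
      Summable fun i => ∑ j, ∑ l, ξ i j l (x i) * dU i j x * dU i l x := by
  have hq : ∀ i, Measurable fun x : ℕ → Fin r → ℝ =>
      ∑ j, ∑ l, ξ i j l (x i) * dU i j x * dU i l x := fun i => by
    have hξ := fun j l => ((hHG i).xi_meas j l).comp
      (measurable_pi_apply (X := fun _ : ℕ => Fin r → ℝ) i)
    have hdU := hU.dU_meas i
    exact Finset.measurable_fun_sum _ fun j _ => Finset.measurable_fun_sum _ fun l _ =>
      ((hξ j l).mul (hdU j)).mul (hdU l)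
  have hfin : ∫⁻ x, ∑' i, ENNReal.ofReal (∑ j, ∑ l, ξ i j l (x i) * dU i j x * dU i l x)
      ∂Measure.infinitePi (blockLaw k) ≠ ⊤ := by
    rw [lintegral_tsum fun i => (hq i).ennreal_ofReal.aemeasurable]
    have heq : ∀ i, ∫⁻ x, ENNReal.ofReal (∑ j, ∑ l, ξ i j l (x i) * dU i j x * dU i l x)
        ∂Measure.infinitePi (blockLaw k) = 2 * ∫⁻ x, ENNReal.ofReal
          (energy r (k i) (ξ i) fun j y => dU i j (Function.update x i y))
          ∂Measure.infinitePi (blockLaw k) := fun i => by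
      rw [lintegral_infinitePi_update _ i (hq i).ennreal_ofReal,
        ← lintegral_const_mul' _ _ (by simp)]
      refine lintegral_congr_ae ?_
      filter_upwards [hU.partialMem i] with x hx
      rw [← hx.lintegral_eq (hHG i)]
      simp [blockLaw]
    simp_rw [heq]
    rw [ENNReal.tsum_mul_left]
    exact ENNReal.mul_ne_top (by simp) hU.energySum.ne
  filter_upwards [ae_lt_top' (Measurable.tsum fun i => (hq i).ennreal_ofReal).aemeasurable
    hfin, ae_nonneg_infinitePi hHG] with x hx hnn
  refine (ENNReal.summable_toReal hx.ne).congr fun i => ?_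
  exact ENNReal.toReal_ofReal (hnn i fun j => dU i j x)

lemma MemDomInfProd.ae_lineDiff (hHG : ∀ i, HG r (k i) (ξ i)) (hk : ∀ i, Integrable (k i))
    (hU : MemDomInfProd r k ξ (Measure.infinitePi (blockLaw k)) U dU) (i : ℕ) (j : Fin r) :
    ∀ᵐ x ∂Measure.infinitePi (blockLaw k), LineDiff U (coordVec i j) (dU i j x) x := by
  refine ae_infinitePi_of_ae_update _ i (measurableSet_lineDiff hU.meas (hU.dU_meas i j) _) ?_
  filter_upwards [hU.partialMem i] with x hx
  refine (ae_withDensity_iff (hHG i).k_meas.ennreal_ofReal).2 ?_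
  filter_upwards [hx.ae_lineDiff (hHG i) (hk i) j] with y hy hne m
  obtain ⟨n, hn⟩ := hy (fun h0 => hne (by simp [h0])) m
  refine ⟨n, ?_⟩
  filter_upwards [hn] with t ht
  rwa [update_add_smul_single] at ht

/-- Almost surely, the partial derivatives of `F` in `d` given coordinates are linearly dependent
at the points that `F` sends into a given null set. -/
lemma ae_det_eq_zero_of_mem_null {ι κ : Type*} [DecidableEq ι] [DecidableEq κ] [Fintype κ]
    [Countable ι] {ν : ι → Measure (κ → ℝ)} [∀ i, IsProbabilityMeasure (ν i)]
    (hν : ∀ i, ν i ≪ volume) {d : ℕ} {F : (ι → κ → ℝ) → Fin d → ℝ} (hF : Measurable F)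
    (c : Fin d → ι × κ) {F' : (ι → κ → ℝ) → Fin d → Fin d → ℝ} (hF' : Measurable F')
    (hline : ∀ b, ∀ᵐ x ∂Measure.infinitePi ν,
      LineDiff F (coordVec (c b).1 (c b).2) (F' x b) x)
    {N : Set (Fin d → ℝ)} (hNm : MeasurableSet N) (hN : volume N = 0) :
    ∀ᵐ x ∂Measure.infinitePi ν, F x ∈ N → (Matrix.of fun a b => F' x b a).det = 0 := by
  set e : Fin d → ι → κ → ℝ := fun b => coordVec (c b).1 (c b).2 with he
  set L : Set (ι → κ → ℝ) := {x | ∀ b, LineDiff F (e b) (F' x b) x} with hL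
  have hLm : MeasurableSet L := by
    rw [hL, Set.ofPred_forall]
    exact MeasurableSet.iInter fun b =>
      measurableSet_lineDiff hF ((measurable_pi_apply b).comp hF') _
  have hdet : Measurable fun x => (Matrix.of fun a b => F' x b a).det := by
    simp only [Matrix.det_apply, Matrix.of_apply]
    have : ∀ b a, Measurable fun x => F' x b a := fun b a =>
      (measurable_pi_apply a).comp ((measurable_pi_apply b).comp hF')
    fun_prop
  have key := ae_notMem_of_slices_infinitePi hν c (D := L ∩ (F ⁻¹' N ∩
    {x | (Matrix.of fun a b => F' x b a).det = 0}ᶜ)) ?_ fun x => ?_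
  · filter_upwards [key, ae_all_iff.2 hline] with x hx hxL hxN
    by_contra h
    exact hx ⟨hxL, hxN, h⟩
  · exact hLm.inter ((hF hNm).inter (hdet (measurableSet_singleton 0)).compl)
  · have hP : Measurable fun s : Fin d → ℝ => x + ∑ b, s b • e b := by
      refine measurable_pi_iff.2 fun i => measurable_pi_iff.2 fun j => ?_
      simp only [Pi.add_apply, Finset.sum_apply, Pi.smul_apply]
      fun_prop
    have hPadd : ∀ (s : Fin d → ℝ) (b : Fin d) (t : ℝ),
        x + ∑ b', (s + t • (Pi.single b (1 : ℝ) : Fin d → ℝ)) b' • e b' =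
          x + ∑ b', s b' • e b' + t • e b := by
      intro s b t
      simp [add_smul, Finset.sum_add_distrib, add_assoc, Pi.single_apply]
    have hlines : ∀ s ∈ (fun s : Fin d → ℝ => x + ∑ b, s b • e b) ⁻¹' L, ∀ b,
        LineDiff (fun s => F (x + ∑ b, s b • e b)) (Pi.single b (1 : ℝ))
          (F' (x + ∑ b, s b • e b) b) s := fun s hs b m => by
      obtain ⟨n, hn⟩ := hs b m
      refine ⟨n, ?_⟩
      filter_upwards [hn] with t ht
      simpa only [hPadd] using ht
    filter_upwards [ae_notMem_null_of_det_ne_zero (hF.comp hP) (hF'.comp hP) (hP hLm) hlines hN]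
      with s hs hsD
    exact hs hsD.1 hsD.2.2 hsD.2.1

end ProductStructure

/-- **EID for an infinite product.** Let each pair `(k_i, ξ^i)`, `i ∈ ℕ*`,
satisfy (HG) with `∫ k_i dx = 1`, and let `Λ` be the product probability `⊗_i k_i dx`
on `(ℝ^r)^{ℕ*}` (characterized by its values on measurable cylinders). Then the infinite
product structure with carré du champ `γ̃ = Σ_i γ_i` satisfies the energy image density
property: for every `d ≥ 1` and `U ∈ 𝐝̃^d`, `U_*[det(γ̃[U_a,U_b]) · Λ] ≪ λ^d`. -/
theorem energy_image_density_infinite_product (r d : ℕ) (hd : 0 < d)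
    (k : ℕ → (Fin r → ℝ) → ℝ) (ξ : ℕ → Fin r → Fin r → (Fin r → ℝ) → ℝ)
    (hHG : ∀ i, HG r (k i) (ξ i))
    (hprob : ∀ i, ∫ y, k i y = 1)
    (Λ : Measure (ℕ → Fin r → ℝ)) (hΛprob : IsProbabilityMeasure Λ)
    (hΛcyl : ∀ (s : Finset ℕ) (A : ℕ → Set (Fin r → ℝ)), (∀ i, MeasurableSet (A i)) →
      Λ {x | ∀ i ∈ s, x i ∈ A i} =
        ∏ i ∈ s, (volume.withDensity fun y => ENNReal.ofReal (k i y)) (A i))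
    (U : Fin d → (ℕ → Fin r → ℝ) → ℝ)
    (dU : Fin d → ℕ → Fin r → (ℕ → Fin r → ℝ) → ℝ)
    (hmem : ∀ a, MemDomInfProd r k ξ Λ (U a) (dU a)) :
    Measure.map (fun x => fun a => U a x)
      (Λ.withDensity fun x => ENNReal.ofReal
        (Matrix.of fun a b : Fin d =>
            ∑' i : ℕ, ∑ j, ∑ l, ξ i j l (x i) * dU a i j x * dU b i l x).det)
      ≪ (volume : Measure (Fin d → ℝ)) := by
  have hk : ∀ i, Integrable (k i) := fun i => integrable_of_integral_eq_one (hprob i)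
  have hν : ∀ i, IsProbabilityMeasure (blockLaw k i) := fun i =>
    isProbabilityMeasure_withDensity_ofReal (hHG i).k_nonneg (hprob i)
  obtain rfl : Λ = Measure.infinitePi (blockLaw k) :=
    Measure.eq_infinitePi _ fun s A hA => hΛcyl s A hA
  have hU : Measurable fun x => fun a => U a x := measurable_pi_iff.2 fun a => (hmem a).meas
  refine Measure.AbsolutelyContinuous.mk fun N hNm hN => ?_
  rw [Measure.map_apply hU hNm, withDensity_apply _ (hU hNm)]
  refine (setLIntegral_congr_fun_ae (g := fun _ => 0) (hU hNm) ?_).trans lintegral_zero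
  have hdep : ∀ c : Fin d → ℕ × Fin r, ∀ᵐ x ∂Measure.infinitePi (blockLaw k),
      (fun a => U a x) ∈ N → (Matrix.of fun a b => dU a (c b).1 (c b).2 x).det = 0 := fun c =>
    ae_det_eq_zero_of_mem_null blockLaw_absolutelyContinuous hU c
      (F' := fun x b a => dU a (c b).1 (c b).2 x)
      (measurable_pi_iff.2 fun b => measurable_pi_iff.2 fun a => (hmem a).dU_meas _ _)
      (fun b => by
        filter_upwards [ae_all_iff.2 fun a => (hmem a).ae_lineDiff hHG hk (c b).1 (c b).2]
          with x hx
        exact lineDiff_pi hx) hNm hN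
  filter_upwards [ae_all_iff.2 hdep, ae_nonneg_infinitePi hHG,
    ae_all_iff.2 fun a => (hmem a).ae_summable hHG] with x hx hnn hsum hxN
  rw [ENNReal.ofReal_eq_zero]
  by_contra hpos
  have hgram : ∀ a b, Summable fun i => ∑ j, ∑ l, ξ i j l (x i) * dU a i j x * dU b i l x :=
    fun a b => summable_bilin_of_summable_quad (ξ := fun i j l => ξ i j l (x i))
      (fun i j l => (hHG i).xi_symm j l _) hnn (hsum a) (hsum b)
  obtain ⟨c, hc⟩ := exists_det_ne_zero_of_det_gram (ξ := fun i j l => ξ i j l (x i))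
    (V := fun a i j => dU a i j x) hgram (not_le.1 hpos).ne'
  exact hc (hx c hxN)
end
end

section
/- Let (X, 𝒳, ν) be a measurable space with all singletons measurable and ν a finite diffuse measure with 0 < ν(X) < ∞, and let (Ω₀, P₀, N) be the concrete Poisson space with intensity ν. Write Ñ(f) = N(f) − ∫ f dν. Then for all real measurable f, g ∈ L¹(ν): E_{P₀}[ e^{i Ñ(f)} Ñ(g) ] = exp( − ∫_X (1 − e^{if} + i f) dν ) · ∫_X (e^{if} − 1) g dν. -/
open MeasureTheory Set Finset
open scoped ENNReal

noncomputable section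

/-- The Poisson law with parameter `t` on `ℕ` : `P({n}) = e^{−t} tⁿ / n!`. -/
def poissonLaw (t : ℝ) : Measure ℕ :=
  Measure.sum fun n =>
    (ENNReal.ofReal (Real.exp (-t) * t ^ n / n.factorial)) • Measure.dirac n

/-- `N(f)(ω) = Σ_{i=1}^n f(x_i)` for a point `ω = (n, x₁, x₂, …)` of the concrete
Poisson space `Ω₀ = ℕ × X^{ℕ*}` (empty sum = 0). -/
def NN {X : Type*} (f : X → ℝ) (ω : ℕ × (ℕ → X)) : ℝ :=
  ∑ i ∈ Finset.range ω.1, f (ω.2 i)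

/-- The σ-field `𝒜 = σ(N(1_A) : A ∈ 𝒳)` on the concrete Poisson space `Ω₀`. -/
def poissonSigmaAlgebra (X : Type*) [MeasurableSpace X] :
    MeasurableSpace (ℕ × (ℕ → X)) :=
  ⨆ (A : Set X) (_ : MeasurableSet A),
    MeasurableSpace.comap (NN (A.indicator fun _ => (1 : ℝ))) inferInstance

/-- The concrete Poisson probability `P₀` with finite intensity `ν` on `Ω₀ = ℕ × X^{ℕ*}`:
the product of the Poisson law of parameter `ν(X)` with the infinite product `Pseq` of
countably many copies of the normalized measure `ν/ν(X)`. -/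
def poissonP0 {X : Type*} [MeasurableSpace X] (ν : Measure X)
    (Pseq : Measure (ℕ → X)) : Measure (ℕ × (ℕ → X)) :=
  (poissonLaw (ν univ).toReal).prod Pseq

/-- `Pseq` is the infinite product of copies of the normalized measure `ν/ν(X)`,
characterized by its values on measurable cylinders. -/
def IsProductOfNormalized {X : Type*} [MeasurableSpace X] (ν : Measure X)
    (Pseq : Measure (ℕ → X)) : Prop :=
  IsProbabilityMeasure Pseq ∧
  ∀ (s : Finset ℕ) (A : ℕ → Set X), (∀ i, MeasurableSet (A i)) →
    Pseq {x | ∀ i ∈ s, x i ∈ A i} = ∏ i ∈ s, ((ν univ)⁻¹ * ν (A i))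

theorem integral_comp_eval_infinitePi {X E : Type*} [MeasurableSpace X] [NormedAddCommGroup E]
    [NormedSpace ℝ E] (μ : Measure X) [IsProbabilityMeasure μ] {g : X → E}
    (hg : AEStronglyMeasurable g μ) (j : ℕ) :
    ∫ x : ℕ → X, g (x j) ∂(Measure.infinitePi fun _ => μ) = ∫ x, g x ∂μ := by
  have hmp := measurePreserving_eval_infinitePi (fun _ : ℕ => μ) j
  have hg' : AEStronglyMeasurable g
      ((Measure.infinitePi fun _ : ℕ => μ).map (Function.eval j)) := by rwa [hmp.map_eq]
  rw [← integral_map hmp.measurable.aemeasurable hg', hmp.map_eq]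

open ProbabilityTheory in
theorem integral_prod_range_infinitePi {X : Type*} [MeasurableSpace X] (μ : Measure X)
    [IsProbabilityMeasure μ] {h : ℕ → X → ℂ} (hh : ∀ i, Measurable (h i)) (n : ℕ) :
    ∫ x : ℕ → X, ∏ i ∈ Finset.range n, h i (x i) ∂(Measure.infinitePi fun _ => μ) =
      ∏ i ∈ Finset.range n, ∫ x, h i x ∂μ := by
  have hind : iIndepFun (fun (i : ℕ) (x : ℕ → X) => x i) (Measure.infinitePi fun _ => μ) :=
    iIndepFun_infinitePi (X := fun _ => id) fun _ => measurable_id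
  have hind' : iIndepFun (fun (i : Fin n) (x : ℕ → X) => x i) (Measure.infinitePi fun _ => μ) :=
    hind.precomp Fin.val_injective
  simp only [Finset.prod_range]
  rw [hind'.integral_fun_prod_comp (f := fun i : Fin n => h i)
    (fun i => (measurable_pi_apply _).aemeasurable) (fun i => (hh i).aestronglyMeasurable)]
  exact Finset.prod_congr rfl fun i _ =>
    integral_comp_eval_infinitePi μ (hh i).aestronglyMeasurable i

theorem integral_prod_range_mul_infinitePi {X : Type*} [MeasurableSpace X] (μ : Measure X)
    [IsProbabilityMeasure μ] {h g : X → ℂ} (hh : Measurable h) (hg : Measurable g)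
    {n j : ℕ} (hj : j ∈ Finset.range n) :
    ∫ x : ℕ → X, (∏ i ∈ Finset.range n, h (x i)) * g (x j) ∂(Measure.infinitePi fun _ => μ) =
      (∫ x, h x ∂μ) ^ (n - 1) * ∫ x, h x * g x ∂μ := by
  have hprod := integral_prod_range_infinitePi μ
    (h := fun i => if i = j then fun x => h x * g x else h)
    (fun i => by split_ifs <;> fun_prop) n
  have hleft : ∀ x : ℕ → X, (∏ i ∈ Finset.range n, h (x i)) * g (x j) =
      ∏ i ∈ Finset.range n, (if i = j then fun x => h x * g x else h) (x i) := fun x => by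
    rw [← Finset.mul_prod_erase _ _ hj, ← Finset.mul_prod_erase _ _ hj, if_pos rfl, mul_right_comm]
    congr 1
    exact Finset.prod_congr rfl fun i hi => by rw [if_neg (Finset.ne_of_mem_erase hi)]
  simp_rw [hleft]
  rw [hprod, ← Finset.mul_prod_erase _ _ hj, if_pos rfl, mul_comm,
    Finset.prod_congr rfl fun i hi => by rw [if_neg (Finset.ne_of_mem_erase hi)]]
  simp [Finset.card_erase_of_mem hj]

theorem integrable_comp_eval_infinitePi {X E : Type*} [MeasurableSpace X] [NormedAddCommGroup E]
    (μ : Measure X) [IsProbabilityMeasure μ] {g : X → E} (hg : Integrable g μ) (j : ℕ) :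
    Integrable (fun x : ℕ → X => g (x j)) (Measure.infinitePi fun _ => μ) :=
  (measurePreserving_eval_infinitePi (fun _ : ℕ => μ) j).integrable_comp_of_integrable hg

theorem hasSum_pow_mul_div_factorial (t z : ℂ) :
    HasSum (fun n : ℕ => t ^ n / n.factorial * z ^ n) (Complex.exp (t * z)) := by
  have := NormedSpace.expSeries_div_hasSum_exp (t * z)
  rw [← Complex.exp_eq_exp_ℂ] at this
  exact this.congr_fun fun n => by rw [mul_pow]; ring

theorem hasSum_nat_mul_pow_mul_div_factorial (t z : ℂ) :
    HasSum (fun n : ℕ => t ^ n / n.factorial * (n * z ^ (n - 1))) (t * Complex.exp (t * z)) := by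
  rw [← hasSum_nat_add_iff' 1]
  simp only [Finset.sum_range_one, Nat.cast_zero, zero_mul, mul_zero, sub_zero]
  refine ((hasSum_pow_mul_div_factorial t z).mul_left t).congr_fun fun n => ?_
  have h1 : (n.factorial : ℂ) ≠ 0 := by exact_mod_cast n.factorial_ne_zero
  have h2 : ((n : ℂ) + 1) ≠ 0 := by exact_mod_cast n.succ_ne_zero
  rw [Nat.factorial_succ, Nat.add_sub_cancel]
  push_cast
  field_simp
  ring

theorem IsProductOfNormalized.eq_infinitePi {X : Type*} [MeasurableSpace X] {ν : Measure X}
    [IsProbabilityMeasure ((ν univ)⁻¹ • ν)] {Pseq : Measure (ℕ → X)}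
    (h : IsProductOfNormalized ν Pseq) :
    Pseq = Measure.infinitePi fun _ => (ν univ)⁻¹ • ν :=
  Measure.eq_infinitePi _ fun s t ht => by
    simpa [Set.pi] using h.2 s t ht

theorem measurable_NN {X : Type*} [MeasurableSpace X] {f : X → ℝ} (hf : Measurable f) :
    Measurable (NN f) :=
  measurable_from_prod_countable_right fun n => by
    exact Finset.measurable_fun_sum (Finset.range n) fun i _ => hf.comp (measurable_pi_apply i)

open ProbabilityTheory in
theorem integrable_natCast_poissonMeasure (r : NNReal) :
    Integrable (fun n : ℕ => (n : ℝ)) (poissonMeasure r) := by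
  rw [integrable_poissonMeasure_iff]
  have := ((hasSum_nat_mul_pow_mul_div_factorial r 1).summable.norm).mul_left (Real.exp (-r))
  refine this.congr fun n => ?_
  simp [mul_div_assoc, mul_assoc]

/-- Conditionally on `n` points, the compensated functional has this expectation. -/
theorem integral_exp_compensated_section {X : Type*} [MeasurableSpace X] (μ : Measure X)
    [IsProbabilityMeasure μ] {f g : X → ℝ} (hf : Measurable f) (hg : Measurable g)
    (hgint : Integrable g μ) (a b : ℝ) (n : ℕ) :
    ∫ x : ℕ → X, Complex.exp (Complex.I * ((NN f (n, x) - a : ℝ) : ℂ)) *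
        ((NN g (n, x) - b : ℝ) : ℂ) ∂(Measure.infinitePi fun _ => μ) =
      Complex.exp (-(Complex.I * a)) *
        (n * (∫ x, Complex.exp (Complex.I * (f x : ℂ)) ∂μ) ^ (n - 1) *
            (∫ x, Complex.exp (Complex.I * (f x : ℂ)) * (g x : ℂ) ∂μ) -
          b * (∫ x, Complex.exp (Complex.I * (f x : ℂ)) ∂μ) ^ n) := by
  set h : X → ℂ := fun x => Complex.exp (Complex.I * (f x : ℂ)) with hh
  have hmeas : Measurable h := by fun_prop
  have hnorm : ∀ x, ‖h x‖ = 1 := fun x => by simp [hh, mul_comm Complex.I]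
  have hexpand : ∀ x : ℕ → X, Complex.exp (Complex.I * ((NN f (n, x) - a : ℝ) : ℂ)) *
        ((NN g (n, x) - b : ℝ) : ℂ) = Complex.exp (-(Complex.I * a)) *
      (∑ j ∈ Finset.range n, (∏ i ∈ Finset.range n, h (x i)) * (g (x j) : ℂ) -
        b * ∏ i ∈ Finset.range n, h (x i)) := fun x => by
    rw [hh, ← Complex.exp_sum, ← Finset.mul_sum, ← Finset.mul_sum]
    simp only [NN, Complex.ofReal_sub, Complex.ofReal_sum]
    rw [mul_sub Complex.I, sub_eq_neg_add (Complex.I * _), Complex.exp_add]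
    ring
  have hprodnorm : ∀ x : ℕ → X, ‖∏ i ∈ Finset.range n, h (x i)‖ = 1 := fun x => by
    simp [norm_prod, hnorm]
  have hprodmeas : Measurable fun x : ℕ → X => ∏ i ∈ Finset.range n, h (x i) := by fun_prop
  have hgint' : Integrable (fun x => (g x : ℂ)) μ := hgint.ofReal
  have hint : ∀ j, Integrable
      (fun x : ℕ → X => (∏ i ∈ Finset.range n, h (x i)) * (g (x j) : ℂ))
      (Measure.infinitePi fun _ => μ) := fun j =>
    (integrable_comp_eval_infinitePi μ hgint' j).bdd_mul
      hprodmeas.aestronglyMeasurable (Filter.Eventually.of_forall fun x => (hprodnorm x).le)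
  have hint' : Integrable (fun x : ℕ → X => ∏ i ∈ Finset.range n, h (x i))
      (Measure.infinitePi fun _ => μ) :=
    (integrable_const (1 : ℝ)).mono' hprodmeas.aestronglyMeasurable
      (Filter.Eventually.of_forall fun x => (hprodnorm x).le)
  simp_rw [hexpand]
  rw [integral_const_mul, integral_sub (integrable_finsetSum _ fun j _ => hint j)
    (hint'.const_mul _), integral_finsetSum _ fun j _ => hint j, integral_const_mul,
    Finset.sum_congr rfl fun j hj =>
      integral_prod_range_mul_infinitePi μ hmeas (by fun_prop : Measurable fun x => (g x : ℂ)) hj,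
    integral_prod_range_infinitePi μ (h := fun _ => h) fun _ => hmeas]
  simp [mul_assoc, hh]

open ProbabilityTheory in
theorem integrable_exp_compensated {X : Type*} [MeasurableSpace X] (μ : Measure X)
    [IsProbabilityMeasure μ] {f g : X → ℝ} (hf : Measurable f) (hg : Measurable g)
    (hgint : Integrable g μ) (a b : ℝ) (r : NNReal) :
    Integrable (fun ω : ℕ × (ℕ → X) => Complex.exp (Complex.I * ((NN f ω - a : ℝ) : ℂ)) *
        ((NN g ω - b : ℝ) : ℂ)) ((poissonMeasure r).prod (Measure.infinitePi fun _ => μ)) := by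
  have hNf := measurable_NN hf
  have hNg := measurable_NN hg
  have hNgint : Integrable (NN g) ((poissonMeasure r).prod (Measure.infinitePi fun _ => μ)) := by
    rw [integrable_prod_iff hNg.aestronglyMeasurable]
    have hsec : ∀ n, Integrable (fun x => NN g (n, x)) (Measure.infinitePi fun _ => μ) :=
      fun n => integrable_finsetSum (Finset.range n) fun j _ => integrable_comp_eval_infinitePi μ hgint j
    refine ⟨Filter.Eventually.of_forall hsec,
      ((integrable_natCast_poissonMeasure r).mul_const (∫ x, ‖g x‖ ∂μ)).mono'
        Measurable.of_discrete.aestronglyMeasurable (Filter.Eventually.of_forall fun n => ?_)⟩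
    have hj : ∀ j, Integrable (fun x : ℕ → X => ‖g (x j)‖) (Measure.infinitePi fun _ => μ) :=
      fun j => integrable_comp_eval_infinitePi μ hgint.norm j
    rw [Real.norm_of_nonneg (integral_nonneg fun _ => norm_nonneg _)]
    calc ∫ x, ‖NN g (n, x)‖ ∂(Measure.infinitePi fun _ => μ)
        ≤ ∫ x : ℕ → X, ∑ j ∈ Finset.range n, ‖g (x j)‖ ∂(Measure.infinitePi fun _ => μ) :=
          integral_mono (hsec n).norm (integrable_finsetSum _ fun j _ => hj j)
            fun x => norm_sum_le _ _
      _ = n * ∫ x, ‖g x‖ ∂μ := by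
          rw [integral_finsetSum _ fun j _ => hj j, Finset.sum_congr rfl fun j _ =>
            integral_comp_eval_infinitePi μ hg.norm.aestronglyMeasurable j]
          simp
  refine (hNgint.sub (integrable_const b)).ofReal.bdd_mul (c := 1)
    (by fun_prop) (Filter.Eventually.of_forall fun ω => ?_)
  rw [mul_comm, Complex.norm_exp_ofReal_mul_I]

/-- On the concrete Poisson space with finite diffuse intensity `ν`,
writing `Ñ(f) = N(f) − ∫ f dν`, for all real `f, g ∈ L¹(ν)` :
`E[e^{iÑ(f)} Ñ(g)] = exp(−∫ (1 − e^{if} + if) dν) · ∫ (e^{if} − 1) g dν`. -/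
theorem poisson_compensated_identity {X : Type*} [MeasurableSpace X]
    [MeasurableSingletonClass X]
    (ν : Measure X) [IsFiniteMeasure ν] (hpos : 0 < ν univ)
    (hdiffuse : ∀ x : X, ν {x} = 0)
    (Pseq : Measure (ℕ → X)) (hPseq : IsProductOfNormalized ν Pseq)
    (f g : X → ℝ) (hfmeas : Measurable f) (hfint : Integrable f ν)
    (hgmeas : Measurable g) (hgint : Integrable g ν) :
    ∫ ω, Complex.exp (Complex.I * ((NN f ω - ∫ x, f x ∂ν : ℝ) : ℂ)) *
        ((NN g ω - ∫ x, g x ∂ν : ℝ) : ℂ) ∂(poissonP0 ν Pseq) =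
      Complex.exp (-∫ x, (1 - Complex.exp (Complex.I * (f x : ℂ)) +
          Complex.I * (f x : ℂ)) ∂ν) *
        ∫ x, (Complex.exp (Complex.I * (f x : ℂ)) - 1) * (g x : ℂ) ∂ν := by
  have hne : ν univ ≠ 0 := hpos.ne'
  have hfin : ν univ ≠ ⊤ := measure_ne_top ν univ
  set t : ℝ := (ν univ).toReal with ht
  have ht0 : (t : ℂ) ≠ 0 := by exact_mod_cast (ENNReal.toReal_pos hne hfin).ne'
  have : NeZero ν := ⟨fun h => hne (by simp [h])⟩
  have hscale : ∀ F : X → ℂ, (t : ℂ) * ∫ x, F x ∂((ν univ)⁻¹ • ν) = ∫ x, F x ∂ν := fun F => by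
    rw [integral_smul_measure, ENNReal.toReal_inv, ← ht, Complex.real_smul, Complex.ofReal_inv,
      mul_inv_cancel_left₀ ht0]
  have hgint' : Integrable g ((ν univ)⁻¹ • ν) := hgint.smul_measure (by simp [hne])
  have hlaw : poissonLaw t = ProbabilityTheory.poissonMeasure (ν univ).toNNReal := rfl
  rw [poissonP0, ← ht, hlaw, hPseq.eq_infinitePi,
    integral_prod _ (integrable_exp_compensated _ hfmeas hgmeas hgint' _ _ _),
    ProbabilityTheory.integral_poissonMeasure]
  simp_rw [integral_exp_compensated_section _ hfmeas hgmeas hgint']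
  set a := ∫ x, f x ∂ν
  set b := ∫ x, g x ∂ν
  set φ := ∫ x, Complex.exp (Complex.I * (f x : ℂ)) ∂((ν univ)⁻¹ • ν) with hφ
  set γ := ∫ x, Complex.exp (Complex.I * (f x : ℂ)) * (g x : ℂ) ∂((ν univ)⁻¹ • ν) with hγ
  have hsum := (((hasSum_nat_mul_pow_mul_div_factorial t φ).mul_right γ).sub
    ((hasSum_pow_mul_div_factorial t φ).mul_left (b : ℂ))).mul_left
      (Complex.exp (-t) * Complex.exp (-(Complex.I * a)))
  have hexpnorm : ∀ x, ‖Complex.exp (Complex.I * (f x : ℂ))‖ ≤ 1 := fun x => by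
    rw [mul_comm, Complex.norm_exp_ofReal_mul_I]
  have hfintC : Integrable (fun x => (f x : ℂ)) ν := hfint.ofReal
  have hgintC : Integrable (fun x => (g x : ℂ)) ν := hgint.ofReal
  have hexpint : Integrable (fun x => Complex.exp (Complex.I * (f x : ℂ))) ν :=
    (integrable_const (1 : ℝ)).mono' (by fun_prop) (Filter.Eventually.of_forall hexpnorm)
  have hexpgint : Integrable (fun x => Complex.exp (Complex.I * (f x : ℂ)) * (g x : ℂ)) ν :=
    hgintC.bdd_mul (by fun_prop) (Filter.Eventually.of_forall hexpnorm)
  have hexponent : ∫ x, (1 - Complex.exp (Complex.I * (f x : ℂ)) +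
      Complex.I * (f x : ℂ)) ∂ν = t - t * φ + Complex.I * a := by
    rw [integral_add (f := fun x => 1 - Complex.exp (Complex.I * (f x : ℂ)))
      ((integrable_const _).sub hexpint) (hfintC.const_mul _),
      integral_sub (integrable_const _) hexpint, integral_const_mul, integral_complex_ofReal,
      hφ, hscale]
    simp [ht, a, Measure.real]
  have hlin : ∫ x, (Complex.exp (Complex.I * (f x : ℂ)) - 1) * (g x : ℂ) ∂ν = t * γ - b := by
    simp_rw [sub_mul, one_mul]
    rw [integral_sub hexpgint hgintC, integral_complex_ofReal, hγ, hscale]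
  rw [hexponent, hlin]
  refine (hsum.congr_fun fun n => ?_).tsum_eq.trans ?_
  · rw [Complex.real_smul]
    change ((Real.exp (-t) * t ^ n / n.factorial : ℝ) : ℂ) * _ = _
    push_cast
    ring
  · rw [show -((t : ℂ) - t * φ + Complex.I * a) = -t + -(Complex.I * a) + t * φ by ring,
      Complex.exp_add, Complex.exp_add]
    ring
end
end
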